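/- Let k ≥ 2, s > 2k and δ = 8^{−2k}. Then, for almost all λ ∈ Λ_k^{(s)} (with respect to Lebesgue measure), there exist a number P_0 = P_0(λ,k) and a positive real number J_{k,s}(λ) such that the inequality |N^{(k)}_λ(P;τ) − 2τ J_{k,s}(λ) P^{s−k}| < P^{s−k−δ} holds for all P ≥ P_0, uniformly in 0 < τ ≤ 1. -/

import Mathlib

open MeasureTheory

/-- δ = 8^{−2k}. -/
noncomputable def dlt (k : ℕ) : ℝ := ((8 : ℝ) ^ (2 * k))⁻¹

/-- Λ_k^{(s)}: s-tuples of nonzero reals; for even k additionally some λ_i λ_j < 0. -/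
def Lam (k s : ℕ) : Set (Fin s → ℝ) :=
  {l | (∀ j, l j ≠ 0) ∧ (Even k → ∃ i j, l i * l j < 0)}

/-- N_λ(P;τ): the number of x ∈ ℤ^s with |x_j| ≤ P and |λ_1x_1^k + ⋯ + λ_sx_s^k| < τ. -/
noncomputable def Ncount (k s : ℕ) (l : Fin s → ℝ) (P τ : ℝ) : ℕ :=
  Set.ncard {x : Fin s → ℤ | (∀ j, |((x j : ℤ) : ℝ)| ≤ P) ∧
    |∑ j, l j * ((x j : ℤ) : ℝ) ^ k| < τ}

open ProbabilityTheory

/-- The standard Gaussian measure on `Fin s → ℝ`. -/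
noncomputable def gaussianPi (s : ℕ) : Measure (Fin s → ℝ) :=
  Measure.pi fun _ => gaussianReal 0 1

instance (s : ℕ) : IsProbabilityMeasure (gaussianPi s) := by
  unfold gaussianPi; infer_instance

lemma volume_absolutelyContinuous_gaussianPi (s : ℕ) :
    (volume : Measure (Fin s → ℝ)) ≪ gaussianPi s := by
  induction s with
  | zero =>
    refine Measure.AbsolutelyContinuous.mk fun t ht h => ?_
    rcases Set.eq_empty_or_nonempty t with rfl | ⟨x, hx⟩
    · simp
    · have : t = Set.univ := by ext y; simp [Subsingleton.elim y x, hx]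
      subst this
      simp at h
  | succ n ih =>
    have h1 := (volume_preserving_piFinSuccAbove (fun _ : Fin (n + 1) => ℝ) 0)
    have h2 := measurePreserving_piFinSuccAbove (fun _ : Fin (n + 1) => gaussianReal 0 1) 0
    have h3 : ((volume : Measure ℝ).prod (volume : Measure (Fin n → ℝ))) ≪
        (gaussianReal 0 1).prod (gaussianPi n) :=
      (gaussianReal_absolutelyContinuous' 0 one_ne_zero).prod ih
    have h4 := (h1.symm).map_eq
    have h5 := (h2.symm).map_eq
    rw [← h4]
    unfold gaussianPi
    rw [← h5]
    exact h3.map (MeasurableEquiv.measurable _)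

lemma hasGaussianLaw_gaussianPi (s : ℕ) :
    HasGaussianLaw (fun (l : Fin s → ℝ) i => l i) (gaussianPi s) := by
  have : iIndepFun (fun (i : Fin s) (l : Fin s → ℝ) => l i) (gaussianPi s) := by
    have := iIndepFun_pi (μ := fun _ : Fin s => gaussianReal 0 1) (X := fun _ x => x)
      (fun _ => aemeasurable_id)
    exact this
  refine iIndepFun.hasGaussianLaw (fun i => ?_) this
  have hmp := measurePreserving_eval (fun _ : Fin s => gaussianReal 0 1) i
  have : HasLaw (fun l : Fin s → ℝ => l i) (gaussianReal 0 1) (gaussianPi s) :=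
    ⟨hmp.measurable.aemeasurable, hmp.map_eq⟩
  exact this.hasGaussianLaw

lemma covariance_gaussianPi (s : ℕ) (i j : Fin s) :
    cov[fun l : Fin s → ℝ => l i, fun l => l j; gaussianPi s] = if i = j then 1 else 0 := by
  have hind : iIndepFun (fun (i : Fin s) (l : Fin s → ℝ) => l i) (gaussianPi s) :=
    iIndepFun_pi (μ := fun _ : Fin s => gaussianReal 0 1) (X := fun _ x => x)
      (fun _ => aemeasurable_id)
  have hG := hasGaussianLaw_gaussianPi s
  split_ifs with h
  · subst h
    have hmp := measurePreserving_eval (fun _ : Fin s => gaussianReal 0 1) i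
    rw [covariance_self (Measurable.aemeasurable (by fun_prop))]
    have := variance_id_gaussianReal (μ := 0) (v := 1)
    rw [← hmp.map_eq, variance_map (by fun_prop) hmp.measurable.aemeasurable] at this
    simpa [gaussianPi] using this
  · exact (hind.indepFun h).covariance_eq_zero (hG.eval i).memLp_two (hG.eval j).memLp_two

lemma covariance_linear_gaussianPi {s : ℕ} (a b : Fin s → ℝ) :
    cov[fun l : Fin s → ℝ => ∑ i, l i * a i, fun l => ∑ i, l i * b i; gaussianPi s]
      = ∑ i, a i * b i := by
  have hG := hasGaussianLaw_gaussianPi s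
  rw [covariance_fun_sum_fun_sum (fun i => (hG.eval i).memLp_two.mul_const _)
    (fun i => (hG.eval i).memLp_two.mul_const _)]
  simp_rw [covariance_mul_const_left, covariance_mul_const_right, covariance_gaussianPi]
  simp [mul_comm]

lemma hasGaussianLaw_linear_gaussianPi {s : ℕ} (a b : Fin s → ℝ) :
    HasGaussianLaw (fun l : Fin s → ℝ => (∑ i, l i * a i, ∑ i, l i * b i)) (gaussianPi s) := by
  let L : (Fin s → ℝ) →L[ℝ] ℝ × ℝ := LinearMap.toContinuousLinearMap
    { toFun := fun l => (∑ i, l i * a i, ∑ i, l i * b i)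
      map_add' := fun x y => by simp [add_mul, Finset.sum_add_distrib]
      map_smul' := fun c x => by simp [Finset.mul_sum, mul_assoc] }
  exact (hasGaussianLaw_gaussianPi s).map_fun L

lemma map_linear_gaussianPi {s : ℕ} (a : Fin s → ℝ) (ha : ∑ i, a i * a i = 1) :
    (gaussianPi s).map (fun l => ∑ i, l i * a i) = gaussianReal 0 1 := by
  have h := (hasGaussianLaw_linear_gaussianPi a a).fst
  rw [h.map_eq_gaussianReal]
  have hG := hasGaussianLaw_gaussianPi s
  congr
  · rw [integral_finsetSum _ (fun i _ => (hG.eval i).integrable.mul_const _)]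
    refine Finset.sum_eq_zero fun i _ => ?_
    rw [integral_mul_const]
    have hmp := measurePreserving_eval (fun _ : Fin s => gaussianReal 0 1) i
    have := integral_id_gaussianReal (μ := 0) (v := 1)
    rw [← hmp.map_eq, integral_map hmp.measurable.aemeasurable (by fun_prop)] at this
    simp only [gaussianPi]
    simp only [Function.eval] at this
    rw [this]; simp
  · rw [← covariance_self (Measurable.aemeasurable (by fun_prop)), covariance_linear_gaussianPi, ha]; simp

lemma map_pair_gaussianPi {s : ℕ} (a b : Fin s → ℝ) (ha : ∑ i, a i * a i = 1)
    (hb : ∑ i, b i * b i = 1) (hab : ∑ i, a i * b i = 0) :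
    (gaussianPi s).map (fun l => (∑ i, l i * a i, ∑ i, l i * b i)) =
      (gaussianReal 0 1).prod (gaussianReal 0 1) := by
  have h := hasGaussianLaw_linear_gaussianPi a b
  have hi := h.indepFun_of_covariance_eq_zero (by rw [covariance_linear_gaussianPi, hab])
  rw [(indepFun_iff_map_prod_eq_prod_map_map
    (Measurable.aemeasurable (by fun_prop)) (Measurable.aemeasurable (by fun_prop))).1 hi,
    map_linear_gaussianPi a ha, map_linear_gaussianPi b hb]

lemma measurableSet_slab_pair (p d c e f : ℝ) :
    MeasurableSet {z : ℝ × ℝ | |p * z.1| < e ∧ |c * z.1 + d * z.2| < f} :=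
  (measurableSet_lt (f := fun z : ℝ × ℝ => |p * z.1|) (g := fun _ => e)
    (by fun_prop) (by fun_prop)).inter
  (measurableSet_lt (f := fun z : ℝ × ℝ => |c * z.1 + d * z.2|) (g := fun _ => f)
    (by fun_prop) (by fun_prop))

lemma volume_slab_pair {p d c e f : ℝ} (hp : 0 < p) (hd : 0 < d) (hf : 0 ≤ f) :
    ((volume : Measure ℝ).prod volume) {z : ℝ × ℝ | |p * z.1| < e ∧ |c * z.1 + d * z.2| < f}
      = ENNReal.ofReal (4 * e * f / (p * d)) := by
  have hm : MeasurableSet {z : ℝ × ℝ | |p * z.1| < e ∧ |c * z.1 + d * z.2| < f} :=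
    measurableSet_slab_pair p d c e f
  rw [Measure.prod_apply hm]
  have h1 : ∀ a : ℝ, volume (Prod.mk a ⁻¹' {z : ℝ × ℝ | |p * z.1| < e ∧ |c * z.1 + d * z.2| < f})
      = (Set.Ioo (-(e / p)) (e / p)).indicator (fun _ => ENNReal.ofReal (2 * f / d)) a := by
    intro a
    have hiff : |p * a| < e ↔ a ∈ Set.Ioo (-(e / p)) (e / p) := by
      rw [abs_mul, abs_of_pos hp, Set.mem_Ioo, ← abs_lt, lt_div_iff₀ hp, mul_comm]
    by_cases ha : a ∈ Set.Ioo (-(e / p)) (e / p)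
    · rw [Set.indicator_of_mem ha]
      have : (Prod.mk a ⁻¹' {z : ℝ × ℝ | |p * z.1| < e ∧ |c * z.1 + d * z.2| < f})
          = Set.Ioo ((-f - c * a) / d) ((f - c * a) / d) := by
        ext b
        change (|p * a| < e ∧ |c * a + d * b| < f) ↔ _
        rw [and_iff_right (hiff.2 ha), abs_lt, Set.mem_Ioo, div_lt_iff₀ hd, lt_div_iff₀ hd]
        constructor <;> rintro ⟨h1, h2⟩ <;> constructor <;> linarith
      rw [this, Real.volume_Ioo]
      congr 1
      field_simp; ring
    · rw [Set.indicator_of_notMem ha]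
      have : (Prod.mk a ⁻¹' {z : ℝ × ℝ | |p * z.1| < e ∧ |c * z.1 + d * z.2| < f}) = ∅ := by
        ext b
        change (|p * a| < e ∧ |c * a + d * b| < f) ↔ False
        rw [hiff]; simp only [ha, false_and]
      rw [this]; simp
  simp_rw [h1]
  rw [lintegral_indicator measurableSet_Ioo, setLIntegral_const, Real.volume_Ioo,
    ← ENNReal.ofReal_mul (by positivity)]
  congr 1
  field_simp; ring

lemma gaussianPDFReal_prod (a b : ℝ) :
    gaussianPDF 0 1 a * gaussianPDF 0 1 b
      = ENNReal.ofReal ((2 * Real.pi)⁻¹ * Real.exp (-(a ^ 2 + b ^ 2) / 2)) := by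
  rw [gaussianPDF, gaussianPDF, ← ENNReal.ofReal_mul (gaussianPDFReal_nonneg _ _ _)]
  congr 1
  simp only [gaussianPDFReal, NNReal.coe_one, mul_one, sub_zero]
  have h : (√(2 * Real.pi))⁻¹ * (√(2 * Real.pi))⁻¹ = (2 * Real.pi)⁻¹ := by
    rw [← mul_inv, Real.mul_self_sqrt (by positivity)]
  calc _ = ((√(2 * Real.pi))⁻¹ * (√(2 * Real.pi))⁻¹) *
      (Real.exp (-a ^ 2 / 2) * Real.exp (-b ^ 2 / 2)) := by ring
    _ = _ := by rw [h, ← Real.exp_add]; congr 2; ring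

lemma gaussianReal_prod_eq_withDensity : (gaussianReal 0 1).prod (gaussianReal 0 1) =
    ((volume : Measure ℝ).prod volume).withDensity
      (fun z => ENNReal.ofReal ((2 * Real.pi)⁻¹ * Real.exp (-(z.1 ^ 2 + z.2 ^ 2) / 2))) := by
  rw [gaussianReal_of_var_ne_zero 0 one_ne_zero,
    prod_withDensity (measurable_gaussianPDF 0 1) (measurable_gaussianPDF 0 1)]
  simp_rw [gaussianPDFReal_prod]

lemma gaussian_slab_pair_le {p d c e f : ℝ} (hp : 0 < p) (hd : 0 < d) (he : 0 ≤ e) (hf : 0 ≤ f) :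
    ((gaussianReal 0 1).prod (gaussianReal 0 1)).real
      {z : ℝ × ℝ | |p * z.1| < e ∧ |c * z.1 + d * z.2| < f}
      ≤ 4 * e * f / (2 * Real.pi * (p * d)) := by
  have hm : MeasurableSet {z : ℝ × ℝ | |p * z.1| < e ∧ |c * z.1 + d * z.2| < f} :=
    measurableSet_slab_pair p d c e f
  apply ENNReal.toReal_le_of_le_ofReal (by positivity)
  rw [gaussianReal_prod_eq_withDensity, withDensity_apply _ hm]
  calc _ ≤ ∫⁻ z in {z : ℝ × ℝ | |p * z.1| < e ∧ |c * z.1 + d * z.2| < f},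
        ENNReal.ofReal ((2 * Real.pi)⁻¹) ∂((volume : Measure ℝ).prod volume) := by
        apply lintegral_mono
        intro z
        apply ENNReal.ofReal_le_ofReal
        refine mul_le_of_le_one_right (by positivity) (Real.exp_le_one_iff.2 ?_)
        have := sq_nonneg z.1; have := sq_nonneg z.2; linarith
    _ = _ := by
        rw [setLIntegral_const, volume_slab_pair hp hd hf, ← ENNReal.ofReal_mul (by positivity)]
        congr 1
        field_simp

lemma le_gaussian_slab_pair {p d c e f : ℝ} (hp : 0 < p) (hd : 0 < d) (he : 0 ≤ e) (hf : 0 ≤ f) :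
    4 * e * f / (2 * Real.pi * (p * d)) *
      (1 - ((e / p) ^ 2 + ((f + |c| * (e / p)) / d) ^ 2) / 2) ≤
    ((gaussianReal 0 1).prod (gaussianReal 0 1)).real
      {z : ℝ × ℝ | |p * z.1| < e ∧ |c * z.1 + d * z.2| < f} := by
  have hm : MeasurableSet {z : ℝ × ℝ | |p * z.1| < e ∧ |c * z.1 + d * z.2| < f} :=
    measurableSet_slab_pair p d c e f
  apply (ENNReal.ofReal_le_iff_le_toReal (measure_ne_top _ _)).1
  rw [gaussianReal_prod_eq_withDensity, withDensity_apply _ hm]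
  calc _ = ∫⁻ z in {z : ℝ × ℝ | |p * z.1| < e ∧ |c * z.1 + d * z.2| < f},
        ENNReal.ofReal ((2 * Real.pi)⁻¹ *
          (1 - ((e / p) ^ 2 + ((f + |c| * (e / p)) / d) ^ 2) / 2))
          ∂((volume : Measure ℝ).prod volume) := by
        rw [setLIntegral_const, volume_slab_pair hp hd hf,
          ← ENNReal.ofReal_mul' (by positivity)]
        congr 1
        field_simp
    _ ≤ _ := by
        apply setLIntegral_mono' hm
        rintro z ⟨h1, h2⟩
        apply ENNReal.ofReal_le_ofReal
        refine mul_le_mul_of_nonneg_left ?_ (by positivity)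
        have h3 : |z.1| ≤ e / p := by
          rw [abs_mul, abs_of_pos hp] at h1
          rw [le_div_iff₀ hp]; linarith
        have h4 : |z.2| ≤ (f + |c| * (e / p)) / d := by
          rw [le_div_iff₀ hd]
          have h5 : |d * z.2| ≤ |c * z.1 + d * z.2| + |c * z.1| := by
            have := abs_sub (c * z.1 + d * z.2) (c * z.1)
            simpa using this
          rw [abs_mul, abs_of_pos hd, abs_mul c] at h5
          have := mul_le_mul_of_nonneg_left h3 (abs_nonneg c)
          linarith
        have h6 : z.1 ^ 2 ≤ (e / p) ^ 2 := by
          rw [← sq_abs]; exact pow_le_pow_left₀ (abs_nonneg _) h3 2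
        have h7 : z.2 ^ 2 ≤ ((f + |c| * (e / p)) / d) ^ 2 := by
          rw [← sq_abs]; exact pow_le_pow_left₀ (abs_nonneg _) h4 2
        have := Real.add_one_le_exp (-(z.1 ^ 2 + z.2 ^ 2) / 2)
        linarith

lemma gaussian_slab_le {p e : ℝ} (hp : 0 < p) (he : 0 ≤ e) :
    (gaussianReal 0 1).real {a : ℝ | |p * a| < e} ≤ e / p := by
  have hm : {a : ℝ | |p * a| < e} = Set.Ioo (-(e / p)) (e / p) := by
    ext a
    rw [Set.mem_ofPred_eq, abs_mul, abs_of_pos hp, Set.mem_Ioo, ← abs_lt, lt_div_iff₀ hp, mul_comm]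
  rw [hm]
  apply ENNReal.toReal_le_of_le_ofReal (by positivity)
  rw [gaussianReal_apply 0 one_ne_zero]
  calc _ ≤ ∫⁻ a in Set.Ioo (-(e / p)) (e / p), ENNReal.ofReal (1 / 2) := by
        apply lintegral_mono
        intro a
        apply ENNReal.ofReal_le_ofReal
        simp only [gaussianPDFReal, NNReal.coe_one, mul_one, sub_zero]
        have h1 : Real.exp (-a ^ 2 / 2) ≤ 1 := Real.exp_le_one_iff.2 (by
          have := sq_nonneg a; linarith)
        have h2 : (√(2 * Real.pi))⁻¹ ≤ 1 / 2 := by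
          rw [one_div]
          apply inv_anti₀ (by norm_num)
          apply Real.le_sqrt_of_sq_le
          have := Real.pi_gt_three; linarith
        calc _ ≤ (√(2 * Real.pi))⁻¹ * 1 := by gcongr
          _ ≤ _ := by simpa using h2
    _ = _ := by
        rw [setLIntegral_const, Real.volume_Ioo, ← ENNReal.ofReal_mul (by positivity)]
        congr 1; ring

/-- The area of the parallelogram spanned by two vectors. -/
noncomputable def wedge {s : ℕ} (X Y : Fin s → ℝ) : ℝ :=
  √((∑ i, ∑ j, (X i * Y j - X j * Y i) ^ 2) / 2)

/-- The Gaussian measure of the intersection of two slabs. -/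
noncomputable def slabMeasure {s : ℕ} (e f : ℝ) (X Y : Fin s → ℝ) : ℝ :=
  (gaussianPi s).real {l | |∑ i, l i * X i| < e ∧ |∑ i, l i * Y i| < f}

lemma wedge_sq {s : ℕ} (X Y : Fin s → ℝ) :
    wedge X Y ^ 2 = (∑ i, X i ^ 2) * (∑ i, Y i ^ 2) - (∑ i, X i * Y i) ^ 2 := by
  rw [wedge, Real.sq_sqrt (by positivity)]
  have h : ∀ i j, (X i * Y j - X j * Y i) ^ 2 =
      X i ^ 2 * Y j ^ 2 + Y i ^ 2 * X j ^ 2 - 2 * ((X i * Y i) * (X j * Y j)) := by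
    intros; ring
  simp_rw [h, Finset.sum_sub_distrib, Finset.sum_add_distrib, ← Finset.mul_sum, ← Finset.sum_mul]
  ring

lemma abs_le_wedge {s : ℕ} (X Y : Fin s → ℝ) (i j : Fin s) :
    |X i * Y j - X j * Y i| ≤ wedge X Y := by
  rw [wedge]
  apply Real.le_sqrt_of_sq_le
  rw [sq_abs, le_div_iff₀ two_pos]
  by_cases hij : i = j
  · subst hij; simp; positivity
  have h0 : ∀ a b, 0 ≤ (X a * Y b - X b * Y a) ^ 2 := fun _ _ => sq_nonneg _
  have h1 : ∀ a b, (X a * Y b - X b * Y a) ^ 2 ≤ ∑ b, (X a * Y b - X b * Y a) ^ 2 := fun a b =>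
    Finset.single_le_sum (f := fun b => (X a * Y b - X b * Y a) ^ 2)
      (fun b _ => h0 a b) (Finset.mem_univ b)
  calc (X i * Y j - X j * Y i) ^ 2 * 2
      = (X i * Y j - X j * Y i) ^ 2 + (X j * Y i - X i * Y j) ^ 2 := by ring
    _ ≤ (∑ b, (X i * Y b - X b * Y i) ^ 2) + ∑ b, (X j * Y b - X b * Y j) ^ 2 :=
        add_le_add (h1 i j) (h1 j i)
    _ = ∑ a ∈ {i, j}, ∑ b, (X a * Y b - X b * Y a) ^ 2 := by rw [Finset.sum_pair hij]
    _ ≤ _ := Finset.sum_le_sum_of_subset_of_nonneg (Finset.subset_univ _)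
        (fun a _ _ => Finset.sum_nonneg fun b _ => h0 a b)

lemma slabMeasure_gaussian_pair {s : ℕ} (e f : ℝ) (X Y : Fin s → ℝ) (hD : 0 < wedge X Y) :
    ∃ n c : ℝ, 0 < n ∧ n ^ 2 = ∑ i, X i ^ 2 ∧ n * c = ∑ i, X i * Y i ∧
      slabMeasure e f X Y = ((gaussianReal 0 1).prod (gaussianReal 0 1)).real
        {z : ℝ × ℝ | |n * z.1| < e ∧ |c * z.1 + (wedge X Y / n) * z.2| < f} := by
  set D := wedge X Y with hDdef
  have hsq := wedge_sq X Y
  rw [← hDdef] at hsq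
  set n := √(∑ i, X i ^ 2) with hn
  have hn2 : n ^ 2 = ∑ i, X i ^ 2 := Real.sq_sqrt (by positivity)
  have hn0 : 0 < n := by
    apply Real.sqrt_pos.2
    have h0 : 0 ≤ ∑ i, X i ^ 2 := by positivity
    refine lt_of_le_of_ne h0 fun h => ?_
    rw [← h] at hsq
    nlinarith [sq_nonneg (∑ i, X i * Y i)]
  set p := ∑ i, X i * Y i with hp
  refine ⟨n, p / n, hn0, hn2, by field_simp, ?_⟩
  let a : Fin s → ℝ := fun i => X i / n
  let b : Fin s → ℝ := fun i => (Y i - p / n ^ 2 * X i) * (n / D)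
  have ha : ∑ i, a i * a i = 1 := by
    have : ∀ i, a i * a i = X i ^ 2 / n ^ 2 := fun i => by simp only [a]; ring
    simp_rw [this, ← Finset.sum_div, ← hn2]
    field_simp
  have hab : ∑ i, a i * b i = 0 := by
    have : ∀ i, a i * b i = (X i * Y i - p / n ^ 2 * X i ^ 2) / D := fun i => by
      simp only [a, b]; field_simp
    simp_rw [this, ← Finset.sum_div, Finset.sum_sub_distrib, ← Finset.mul_sum, ← hn2, ← hp]
    field_simp; ring
  have hb : ∑ i, b i * b i = 1 := by
    have : ∀ i, b i * b i =
        (Y i ^ 2 - 2 * (p / n ^ 2) * (X i * Y i) + (p / n ^ 2) ^ 2 * X i ^ 2) * (n / D) ^ 2 :=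
      fun i => by simp only [b]; ring
    simp_rw [this, ← Finset.sum_mul, Finset.sum_add_distrib, Finset.sum_sub_distrib,
      ← Finset.mul_sum, ← hn2, ← hp]
    rw [← hn2] at hsq
    field_simp
    linarith
  have hmap := map_pair_gaussianPi a b ha hb hab
  rw [← hmap, measureReal_def, Measure.map_apply (by fun_prop) (measurableSet_slab_pair _ _ _ _ _),
    slabMeasure, measureReal_def]
  congr 2
  ext l
  have h1 : n * ∑ i, l i * a i = ∑ i, l i * X i := by
    rw [Finset.mul_sum]
    refine Finset.sum_congr rfl fun i _ => ?_
    simp only [a]; field_simp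
  have h2 : p / n * ∑ i, l i * a i + D / n * ∑ i, l i * b i = ∑ i, l i * Y i := by
    rw [Finset.mul_sum, Finset.mul_sum, ← Finset.sum_add_distrib]
    refine Finset.sum_congr rfl fun i _ => ?_
    simp only [a, b]; field_simp; ring
  change _ ↔ |n * ∑ i, l i * a i| < e ∧ |p / n * ∑ i, l i * a i + D / n * ∑ i, l i * b i| < f
  rw [h1, h2]; rfl

lemma slabMeasure_le {s : ℕ} {e f : ℝ} (he : 0 ≤ e) (hf : 0 ≤ f) (X Y : Fin s → ℝ)
    (hD : 0 < wedge X Y) : slabMeasure e f X Y ≤ 4 * e * f / (2 * Real.pi * wedge X Y) := by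
  obtain ⟨n, c, hn, -, -, h⟩ := slabMeasure_gaussian_pair e f X Y hD
  rw [h]
  have := gaussian_slab_pair_le (c := c) hn (div_pos hD hn) he hf
  rwa [mul_div_cancel₀ _ hn.ne'] at this

/-- Two-dimensional Gaussian density estimate for the intersection of two slabs. -/
lemma le_slabMeasure {s : ℕ} {e f B : ℝ} (he : 0 ≤ e) (hf : 0 ≤ f) (X Y : Fin s → ℝ)
    (hD : 0 < wedge X Y) (hB : 0 ≤ B) (hX : ∑ i, X i ^ 2 ≤ B ^ 2) (hY : ∑ i, Y i ^ 2 ≤ B ^ 2) :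
    4 * e * f / (2 * Real.pi * wedge X Y) * (1 - (B * (e + f) / wedge X Y) ^ 2)
      ≤ slabMeasure e f X Y := by
  obtain ⟨n, c, hn, hn2, hc, h⟩ := slabMeasure_gaussian_pair e f X Y hD
  rw [h]
  have h1 := le_gaussian_slab_pair (c := c) hn (div_pos hD hn) he hf
  rw [mul_div_cancel₀ _ hn.ne'] at h1
  refine le_trans ?_ h1
  refine mul_le_mul_of_nonneg_left ?_ (by positivity)
  set D := wedge X Y with hDdef
  have hsq := wedge_sq X Y
  rw [← hDdef, ← hn2, ← hc] at hsq
  have hnB : n ≤ B := by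
    apply le_of_sq_le_sq _ hB
    rw [hn2]; exact hX
  have hn2B : n ^ 2 * ∑ i, Y i ^ 2 ≤ n ^ 2 * B ^ 2 := by gcongr
  have hDn : D ≤ n * B := by
    apply le_of_sq_le_sq _ (by positivity)
    nlinarith [sq_nonneg (n * c)]
  have hcB : |c| ≤ B := by
    apply abs_le_of_sq_le_sq _ hB
    have h3 : n ^ 2 * c ^ 2 ≤ n ^ 2 * B ^ 2 := by nlinarith [sq_nonneg D]
    exact le_of_mul_le_mul_left h3 (by positivity)
  have h4 : e / n ≤ B * (e + f) / D := by
    rw [div_le_div_iff₀ hn hD]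
    have : e * D ≤ e * (n * B) := by gcongr
    have : 0 ≤ f * n * B := by positivity
    nlinarith
  have h5 : (f + |c| * (e / n)) / (D / n) ≤ B * (e + f) / D := by
    have : (f + |c| * (e / n)) / (D / n) = (f * n + |c| * e) / D := by field_simp
    rw [this]
    gcongr
    nlinarith [mul_le_mul_of_nonneg_left hnB hf, mul_le_mul_of_nonneg_right hcB he]
  have h6 : (e / n) ^ 2 ≤ (B * (e + f) / D) ^ 2 := by gcongr
  have h7 : ((f + |c| * (e / n)) / (D / n)) ^ 2 ≤ (B * (e + f) / D) ^ 2 := by gcongr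
  linarith

lemma slabMeasure_le_left {s : ℕ} {e f : ℝ} (he : 0 ≤ e) (X Y : Fin s → ℝ) {R : ℝ} (hR : 0 < R)
    (j : Fin s) (hj : R ≤ |X j|) : slabMeasure e f X Y ≤ e / R := by
  set n := √(∑ i, X i ^ 2) with hn
  have hn2 : n ^ 2 = ∑ i, X i ^ 2 := Real.sq_sqrt (by positivity)
  have hRn : R ≤ n := by
    refine hj.trans (Real.le_sqrt_of_sq_le ?_)
    rw [sq_abs]
    exact Finset.single_le_sum (f := fun i => X i ^ 2) (fun i _ => sq_nonneg _) (Finset.mem_univ j)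
  have hn0 : 0 < n := hR.trans_le hRn
  let a : Fin s → ℝ := fun i => X i / n
  have ha : ∑ i, a i * a i = 1 := by
    have : ∀ i, a i * a i = X i ^ 2 / n ^ 2 := fun i => by simp only [a]; ring
    simp_rw [this, ← Finset.sum_div, ← hn2]
    field_simp
  have hm : MeasurableSet {z : ℝ | |n * z| < e} :=
    measurableSet_lt (f := fun z : ℝ => |n * z|) (g := fun _ => e) (by fun_prop) (by fun_prop)
  calc slabMeasure e f X Y ≤ (gaussianPi s).real {l | |∑ i, l i * X i| < e} :=
        measureReal_mono (fun l hl => hl.1)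
    _ = (gaussianReal 0 1).real {a : ℝ | |n * a| < e} := by
        rw [← map_linear_gaussianPi a ha, measureReal_def, measureReal_def,
          Measure.map_apply (by fun_prop) hm]
        congr 2
        ext l
        have h1 : n * ∑ i, l i * a i = ∑ i, l i * X i := by
          rw [Finset.mul_sum]
          refine Finset.sum_congr rfl fun i _ => ?_
          simp only [a]; field_simp
        change _ ↔ |n * ∑ i, l i * a i| < e
        rw [h1]; rfl
    _ ≤ e / n := gaussian_slab_le hn0 he
    _ ≤ e / R := by gcongr

lemma wedge_eq_norm {s : ℕ} (X Y : Fin s → ℝ) :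
    wedge X Y = ‖WithLp.toLp 2 (fun p : Fin s × Fin s => (X p.1 * Y p.2 - X p.2 * Y p.1) / √2)‖ := by
  rw [EuclideanSpace.norm_eq, wedge, Fintype.sum_prod_type, Finset.sum_div]
  congr 1
  refine Finset.sum_congr rfl fun i _ => ?_
  rw [Finset.sum_div]
  refine Finset.sum_congr rfl fun j _ => ?_
  simp [div_pow]

lemma wedge_sub_wedge_le {s : ℕ} {X Y X' Y' : Fin s → ℝ} {e : ℝ}
    (hY : ∀ i, |Y i| ≤ 1) (hX' : ∀ i, |X' i| ≤ 1)
    (hXX : ∀ i, |X i - X' i| ≤ e) (hYY : ∀ i, |Y i - Y' i| ≤ e) :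
    |wedge X Y - wedge X' Y'| ≤ 4 * s * e := by
  rcases Nat.eq_zero_or_pos s with rfl | hs
  · simp [wedge]
  have he : 0 ≤ e := (abs_nonneg _).trans (hXX ⟨0, hs⟩)
  rw [wedge_eq_norm, wedge_eq_norm]
  refine (abs_norm_sub_norm_le _ _).trans ?_
  rw [EuclideanSpace.norm_eq]
  apply Real.sqrt_le_iff.2 ⟨by positivity, ?_⟩
  have h : ∀ p ∈ (Finset.univ : Finset (Fin s × Fin s)),
      ‖(WithLp.toLp 2 (fun p : Fin s × Fin s => (X p.1 * Y p.2 - X p.2 * Y p.1) / √2) -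
      WithLp.toLp 2 (fun p : Fin s × Fin s => (X' p.1 * Y' p.2 - X' p.2 * Y' p.1) / √2)) p‖ ^ 2
      ≤ 16 * e ^ 2 := by
    intro p _
    have hab : ∀ i j, |X i * Y j - X' i * Y' j| ≤ 2 * e := fun i j => by
      have : X i * Y j - X' i * Y' j = (X i - X' i) * Y j + X' i * (Y j - Y' j) := by ring
      rw [this]
      refine (abs_add_le _ _).trans ?_
      rw [abs_mul, abs_mul]
      have h1 := mul_le_mul (hXX i) (hY j) (abs_nonneg _) he
      have h2 := mul_le_mul (hX' i) (hYY j) (abs_nonneg _) zero_le_one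
      linarith
    have h3 : |(X p.1 * Y p.2 - X p.2 * Y p.1) - (X' p.1 * Y' p.2 - X' p.2 * Y' p.1)| ≤ 4 * e := by
      have := abs_sub (X p.1 * Y p.2 - X' p.1 * Y' p.2) (X p.2 * Y p.1 - X' p.2 * Y' p.1)
      have h1 := hab p.1 p.2
      have h2 := hab p.2 p.1
      rw [show (X p.1 * Y p.2 - X p.2 * Y p.1) - (X' p.1 * Y' p.2 - X' p.2 * Y' p.1) =
        (X p.1 * Y p.2 - X' p.1 * Y' p.2) - (X p.2 * Y p.1 - X' p.2 * Y' p.1) by ring]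
      linarith
    simp only [PiLp.sub_apply, ← sub_div, Real.norm_eq_abs, sq_abs, div_pow]
    rw [Real.sq_sqrt zero_le_two]
    have h4 := sq_le_sq' (by linarith [(abs_le.1 h3).1]) (abs_le.1 h3).2
    nlinarith [sq_nonneg (X p.1 * Y p.2 - X p.2 * Y p.1 - (X' p.1 * Y' p.2 - X' p.2 * Y' p.1))]
  refine (Finset.sum_le_sum h).trans ?_
  simp
  nlinarith

/-- The kernel `(max h t)⁻ᶿ`, valued in `[0, ∞]`. -/
noncomputable def singKernel (a h t : ℝ) : ENNReal := ENNReal.ofReal ((max h t) ^ (-a))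

lemma singKernel_le {a h t : ℝ} (ha : 0 ≤ a) (ha' : a ≤ 3 / 4) (hh : 0 < h) :
    singKernel a h |t| ≤ 1 + (ENNReal.ofReal |t|) ^ (-(3 / 4) : ℝ) := by
  have hm : 0 < max h |t| := lt_max_of_lt_left hh
  rw [singKernel]
  rcases le_total 1 (max h |t|) with h1 | h1
  · refine le_trans ?_ le_self_add
    rw [ENNReal.ofReal_le_one]
    exact Real.rpow_le_one_of_one_le_of_nonpos h1 (by linarith)
  · refine le_trans ?_ le_add_self
    rcases eq_or_ne t 0 with rfl | ht
    · simp [ENNReal.zero_rpow_of_neg]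
    have ht' : 0 < |t| := abs_pos.2 ht
    rw [ENNReal.ofReal_rpow_of_pos ht']
    apply ENNReal.ofReal_le_ofReal
    calc (max h |t|) ^ (-a) ≤ (max h |t|) ^ (-(3 / 4) : ℝ) :=
          Real.rpow_le_rpow_of_exponent_ge hm h1 (by linarith)
      _ ≤ _ := Real.rpow_le_rpow_of_nonpos ht' (le_max_right _ _) (by norm_num)

lemma lintegral_Icc_abs_rpow_ne_top :
    ∫⁻ t in Set.Icc (-1 : ℝ) 1, (ENNReal.ofReal |t|) ^ (-(3 / 4) : ℝ) ≠ ⊤ := by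
  set f : ℝ → ENNReal := fun t => (ENNReal.ofReal |t|) ^ (-(3 / 4) : ℝ) with hf
  have h1 : ∫⁻ t in Set.Ioc (0 : ℝ) 1, f t ≠ ⊤ := by
    have := (intervalIntegral.intervalIntegrable_rpow' (a := 0) (b := 1)
      (r := (-(3 / 4) : ℝ)) (by norm_num)).1.lintegral_lt_top
    refine (lt_of_le_of_lt ?_ this).ne
    refine lintegral_mono_ae ?_
    filter_upwards [ae_restrict_mem measurableSet_Ioc] with t ht
    rw [hf]
    simp only
    rw [abs_of_pos ht.1, ENNReal.ofReal_rpow_of_pos ht.1]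
  have h2 : ∫⁻ t in Set.Ico (-1 : ℝ) 0, f t = ∫⁻ t in Set.Ioc (0 : ℝ) 1, f t := by
    rw [← lintegral_indicator measurableSet_Ico, ← lintegral_indicator measurableSet_Ioc,
      ← lintegral_neg_eq_self]
    congr 1 with t
    simp [Set.indicator_apply, hf, and_comm, neg_le]
  have h3 : Set.Icc (-1 : ℝ) 1 ⊆ Set.Ico (-1) 0 ∪ ({0} ∪ Set.Ioc 0 1) := by
    intro t ht
    rcases lt_trichotomy t 0 with h | h | h
    · exact Or.inl ⟨ht.1, h⟩
    · exact Or.inr (Or.inl h)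
    · exact Or.inr (Or.inr ⟨h, ht.2⟩)
  refine (lt_of_le_of_lt ((lintegral_mono_set h3).trans ((lintegral_union_le _ _ _).trans
    (add_le_add le_rfl (lintegral_union_le _ _ _)))) ?_).ne
  rw [h2]
  have h4 : ∫⁻ t in ({0} : Set ℝ), f t = 0 := by simp
  rw [h4, zero_add]
  exact ENNReal.add_lt_top.2 ⟨h1.lt_top, h1.lt_top⟩

/-- Lebesgue measure on `[-1, 1)`. -/
noncomputable def cubeLine : Measure ℝ := volume.restrict (Set.Ico (-1) 1)

/-- Lebesgue measure on the cube `[-1, 1)ˢ`. -/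
noncomputable def cubeVol (s : ℕ) : Measure (Fin s → ℝ) := Measure.pi fun _ => cubeLine

lemma cubeLine_univ : cubeLine Set.univ = 2 := by
  rw [cubeLine, Measure.restrict_apply_univ, Real.volume_Ico]
  norm_num

instance : IsFiniteMeasure cubeLine := ⟨by rw [cubeLine_univ]; simp⟩

instance (s : ℕ) : IsFiniteMeasure (cubeVol s) := by unfold cubeVol; infer_instance

lemma cubeVol_univ (s : ℕ) : cubeVol s Set.univ = 2 ^ s := by
  simp [cubeVol, Measure.pi_univ, cubeLine_univ]

lemma ae_cubeVol (s : ℕ) : ∀ᵐ v ∂cubeVol s, ∀ i, v i ∈ Set.Ico (-1 : ℝ) 1 := by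
  rw [ae_all_iff]
  intro i
  have h : ∀ᵐ t ∂cubeLine, t ∈ Set.Ico (-1 : ℝ) 1 := ae_restrict_mem measurableSet_Ico
  exact (Measure.tendsto_eval_ae_ae (μ := fun _ : Fin s => cubeLine) (i := i)).eventually h

/-- Uniform bound for one-dimensional singular integrals. -/
lemma exists_lintegral_singKernel_le : ∃ C : ENNReal, C ≠ ⊤ ∧ 1 ≤ C ∧
    ∀ a h c : ℝ, 0 ≤ a → a ≤ 3 / 4 → 0 < h →
      ∫⁻ v, singKernel a h |(|v| - c)| ∂cubeLine ≤ C := by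
  set f : ℝ → ENNReal := fun t => (ENNReal.ofReal |t|) ^ (-(3 / 4) : ℝ) with hf
  have hfm : Measurable f := by fun_prop
  set I := ∫⁻ t in Set.Icc (-1 : ℝ) 1, f t with hI
  have hIt : I ≠ ⊤ := lintegral_Icc_abs_rpow_ne_top
  have hsmall : ∀ c : ℝ, ∫⁻ v, f (v - c) ∂cubeLine ≤ 2 + I := by
    intro c
    have hp : ∀ t, f t ≤ 1 + (Set.Icc (-1 : ℝ) 1).indicator f t := by
      intro t
      by_cases ht : t ∈ Set.Icc (-1 : ℝ) 1
      · rw [Set.indicator_of_mem ht]; exact le_add_self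
      · rw [Set.indicator_of_notMem ht, add_zero]
        have h1 : 1 < |t| := by
          by_contra h; exact ht (abs_le.1 (not_lt.1 h))
        exact ENNReal.rpow_le_one_of_one_le_of_neg (by simpa using h1.le) (by norm_num)
    calc ∫⁻ v, f (v - c) ∂cubeLine
        ≤ ∫⁻ v, (1 + (Set.Icc (-1 : ℝ) 1).indicator f (v - c)) ∂cubeLine :=
          lintegral_mono fun v => hp _
      _ = 2 + ∫⁻ v, (Set.Icc (-1 : ℝ) 1).indicator f (v - c) ∂cubeLine := by
          rw [lintegral_add_left measurable_const, lintegral_one, cubeLine_univ]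
      _ ≤ 2 + ∫⁻ v, (Set.Icc (-1 : ℝ) 1).indicator f (v - c) := by
          gcongr; exact Measure.restrict_le_self
      _ = 2 + I := by
          rw [lintegral_sub_right_eq_self (fun v => (Set.Icc (-1 : ℝ) 1).indicator f v) c,
            lintegral_indicator measurableSet_Icc]
  refine ⟨2 + ((2 + I) + (2 + I)), by simp [hIt], ?_, ?_⟩
  · exact le_trans (by norm_num) le_self_add
  intro a h c ha ha' hh
  have hp : ∀ v : ℝ, singKernel a h |(|v| - c)| ≤ 1 + (f (v - c) + f (v - (-c))) := by
    intro v
    refine (singKernel_le ha ha' hh).trans ?_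
    gcongr
    rcases le_total 0 v with hv | hv
    · rw [abs_of_nonneg hv]; exact le_self_add
    · rw [abs_of_nonpos hv, ← abs_neg, show -(-v - c) = v - -c by ring]; exact le_add_self
  calc _ ≤ _ := lintegral_mono hp
    _ = 2 + (∫⁻ v, f (v - c) ∂cubeLine + ∫⁻ v, f (v - (-c)) ∂cubeLine) := by
        rw [lintegral_add_left measurable_const, lintegral_one, cubeLine_univ,
          lintegral_add_left (by fun_prop)]
    _ ≤ _ := by gcongr <;> exact hsmall _

lemma measurable_singKernel (a h : ℝ) : Measurable (singKernel a h) := by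
  unfold singKernel; fun_prop

lemma lintegral_cubeVol_succAbove {n : ℕ} (j : Fin (n + 1)) {F : (Fin (n + 1) → ℝ) → ENNReal}
    (hF : Measurable F) :
    ∫⁻ v, F v ∂cubeVol (n + 1) = ∫⁻ t, ∫⁻ w, F (j.insertNth t w) ∂cubeVol n ∂cubeLine := by
  have hmp := (measurePreserving_piFinSuccAbove (fun _ : Fin (n + 1) => cubeLine) j).symm
  have : ∫⁻ v, F v ∂cubeVol (n + 1) =
      ∫⁻ z, F (j.insertNth z.1 z.2) ∂(cubeLine.prod (cubeVol n)) := by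
    unfold cubeVol
    rw [← hmp.lintegral_comp_emb (MeasurableEquiv.measurableEmbedding _)]
    rfl
  rw [this, lintegral_prod]
  refine Measurable.aemeasurable ?_
  exact hF.comp (MeasurableEquiv.piFinSuccAbove (fun _ : Fin (n + 1) => ℝ) j).symm.measurable

lemma lintegral_cubeVol_prod {n : ℕ} (f : Fin n → ℝ → ENNReal) (hf : ∀ i, Measurable (f i)) :
    ∫⁻ v, ∏ i, f i (v i) ∂cubeVol n = ∏ i, ∫⁻ t, f i t ∂cubeLine := by
  induction n with
  | zero => simp [cubeVol_univ]
  | succ n ih =>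
    rw [lintegral_cubeVol_succAbove 0 (by fun_prop), Fin.prod_univ_succ]
    have : ∀ t, ∫⁻ w, ∏ i, f i (Fin.insertNth (α := fun _ => ℝ) 0 t w i) ∂cubeVol n =
        f 0 t * ∏ i : Fin n, ∫⁻ t, f i.succ t ∂cubeLine := by
      intro t
      have h0 : ∀ w : Fin n → ℝ, ∏ i, f i (Fin.insertNth (α := fun _ => ℝ) 0 t w i) =
          f 0 t * ∏ i : Fin n, f i.succ (w i) := fun w => by
        rw [Fin.prod_univ_succ]
        rfl
      simp_rw [h0]
      rw [lintegral_const_mul _ (by fun_prop), ih (fun i => f i.succ) fun i => hf _]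
    simp_rw [this]
    rw [lintegral_mul_const _ (hf 0)]

lemma slabMeasure_nonneg {s : ℕ} (e f : ℝ) (X Y : Fin s → ℝ) : 0 ≤ slabMeasure e f X Y :=
  measureReal_nonneg

lemma slabMeasure_le_one {s : ℕ} (e f : ℝ) (X Y : Fin s → ℝ) : slabMeasure e f X Y ≤ 1 :=
  measureReal_le_one

lemma abs_sub_le_of_mem_Icc {a b m : ℝ} (ha : 0 ≤ a) (ha' : a ≤ m) (hb : 0 ≤ b) (hb' : b ≤ m) :
    |a - b| ≤ m := abs_le.2 ⟨by linarith, by linarith⟩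

lemma slabMeasure_div_le {s : ℕ} {e f : ℝ} (he : 0 < e) (hf : 0 < f) (X Y : Fin s → ℝ)
    (hD : 0 < wedge X Y) : slabMeasure e f X Y / (4 * e * f) ≤ 1 / (2 * Real.pi * wedge X Y) := by
  rw [div_le_iff₀ (by positivity)]
  refine (slabMeasure_le he.le hf.le X Y hD).trans (le_of_eq ?_)
  ring

lemma abs_slabMeasure_div_sub_le {s : ℕ} {e f H d B : ℝ} (he : 0 < e) (hf : 0 < f)
    (heH : e ≤ H) (hfH : f ≤ H) (hd : 0 < d) (X Y : Fin s → ℝ) (hD : d ≤ wedge X Y)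
    (hB : 0 < B) (hX : ∑ i, X i ^ 2 ≤ B ^ 2) (hY : ∑ i, Y i ^ 2 ≤ B ^ 2) :
    |slabMeasure e f X Y / (4 * e * f) - 1 / (2 * Real.pi * max (wedge X Y) d)|
      ≤ 4 * B ^ 2 * H ^ 2 / d ^ 3 := by
  have hD0 : 0 < wedge X Y := hd.trans_le hD
  have hpi := Real.pi_gt_three
  rw [max_eq_left hD]
  set D := wedge X Y
  have h1 := slabMeasure_div_le he hf X Y hD0
  have h2 : 1 / (2 * Real.pi * D) * (1 - (B * (e + f) / D) ^ 2) ≤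
      slabMeasure e f X Y / (4 * e * f) := by
    rw [le_div_iff₀ (by positivity)]
    refine le_trans (le_of_eq ?_) (le_slabMeasure he.le hf.le X Y hD0 hB.le hX hY)
    change _ = 4 * e * f / (2 * Real.pi * D) * _
    ring
  have h3 : 1 / (2 * Real.pi * D) * (B * (e + f) / D) ^ 2 ≤ 4 * B ^ 2 * H ^ 2 / d ^ 3 := by
    have h4 : 1 / (2 * Real.pi * D) ≤ 1 / d := by
      apply one_div_le_one_div_of_le hd
      nlinarith
    have h5 : (B * (e + f) / D) ^ 2 ≤ (B * (2 * H) / d) ^ 2 := by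
      have h6 : e + f ≤ 2 * H := by linarith
      have h7 : B * (e + f) / D ≤ B * (2 * H) / d := by
        rw [div_le_div_iff₀ hD0 hd]
        exact mul_le_mul (by gcongr) hD hd.le (by have := he.le.trans heH; positivity)
      gcongr
    calc _ ≤ 1 / d * (B * (2 * H) / d) ^ 2 := by gcongr
      _ = _ := by field_simp; ring
  rw [abs_le]
  constructor
  · nlinarith
  · have : 0 ≤ 4 * B ^ 2 * H ^ 2 / d ^ 3 := by positivity
    change _ ≤ 1 / (2 * Real.pi * D) at h1
    linarith

lemma one_div_two_pi_max_le {D d : ℝ} (hd : 0 < d) :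
    1 / (2 * Real.pi * max D d) ≤ 1 / d := by
  have hpi := Real.pi_gt_three
  apply one_div_le_one_div_of_le hd
  nlinarith [le_max_right D d]

lemma one_div_two_pi_max_nonneg {D d : ℝ} (hd : 0 < d) :
    0 ≤ 1 / (2 * Real.pi * max D d) := by
  have := lt_max_of_lt_right (b := D) hd
  have hpi := Real.pi_pos
  positivity

lemma abs_slabMeasure_div_sub_le_small {s : ℕ} {e f d : ℝ} (he : 0 < e) (hf : 0 < f)
    (hd : 0 < d) (X Y : Fin s → ℝ) (hD : wedge X Y < d) (j : Fin s) (hj : 0 < |X j|)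
    (hfd : f * |X j| ≤ d) :
    |slabMeasure e f X Y / (4 * e * f) - 1 / (2 * Real.pi * max (wedge X Y) d)|
      ≤ 1 / max (wedge X Y) (f * |X j|) := by
  have hpi := Real.pi_gt_three
  have hfx : 0 < f * |X j| := by positivity
  have hM : 0 < max (wedge X Y) (f * |X j|) := lt_max_of_lt_right hfx
  apply abs_sub_le_of_mem_Icc
  · have := slabMeasure_nonneg e f X Y; positivity
  · rcases le_total (wedge X Y) (f * |X j|) with h | h
    · rw [max_eq_right h, div_le_div_iff₀ (by positivity) hfx]
      have h1 := slabMeasure_le_left (f := f) he.le X Y hj j le_rfl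
      rw [le_div_iff₀ hj] at h1
      nlinarith [mul_pos he hf]
    · have hD0 : 0 < wedge X Y := hfx.trans_le h
      rw [max_eq_left h]
      refine (slabMeasure_div_le he hf X Y hD0).trans ?_
      apply one_div_le_one_div_of_le hD0
      nlinarith
  · exact one_div_two_pi_max_nonneg hd
  · refine (one_div_two_pi_max_le hd).trans ?_
    exact one_div_le_one_div_of_le hM (max_le hD.le hfd)

lemma abs_slabMeasure_div_sub_le_trivial {s : ℕ} {e f d : ℝ} (he : 0 < e) (hf : 0 < f)
    (hd : 0 < d) (X Y : Fin s → ℝ) :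
    |slabMeasure e f X Y / (4 * e * f) - 1 / (2 * Real.pi * max (wedge X Y) d)|
      ≤ 1 / (4 * e * f) + 1 / d := by
  have h1 : slabMeasure e f X Y / (4 * e * f) ≤ 1 / (4 * e * f) := by
    have := slabMeasure_le_one e f X Y
    gcongr
  have h2 := one_div_two_pi_max_le (D := wedge X Y) hd
  have h3 := one_div_two_pi_max_nonneg (D := wedge X Y) hd
  have h4 : 0 ≤ slabMeasure e f X Y / (4 * e * f) := by
    have := slabMeasure_nonneg e f X Y; positivity
  exact abs_sub_le_of_mem_Icc h4 (by linarith) h3 (by linarith)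

lemma abs_sub_pow_le_abs_pow_sub {a b : ℝ} (ha : 0 ≤ a) (hb : 0 ≤ b) {k : ℕ} (hk : k ≠ 0) :
    |a - b| ^ k ≤ |a ^ k - b ^ k| := by
  wlog hab : b ≤ a generalizing a b
  · rw [abs_sub_comm, abs_sub_comm (a ^ k)]
    exact this hb ha (le_of_not_ge hab)
  have h1 : b ^ k ≤ a ^ k := by gcongr
  rw [abs_of_nonneg (sub_nonneg.2 hab), abs_of_nonneg (sub_nonneg.2 h1)]
  have h2 := pow_add_pow_le (sub_nonneg.2 hab) hb hk
  rw [sub_add_cancel] at h2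
  linarith

/-- Lower bound for the wedge of two power vectors in terms of one coordinate pair. -/
lemma pow_le_wedge_pow {s k : ℕ} (hk : k ≠ 0) (x y : Fin s → ℝ) (i j : Fin s) (hj : x j ≠ 0) :
    (|x j| * |(|y i| - |x i * y j / x j|)|) ^ k ≤
      wedge (fun i => x i ^ k) (fun i => y i ^ k) := by
  refine le_trans ?_ (abs_le_wedge _ _ j i)
  have h0 : 0 < |x j| := abs_pos.2 hj
  have h1 : |x j| * |(|y i| - |x i * y j / x j|)| = |(|x j * y i| - |x i * y j|)| := by
    nth_rw 1 [← abs_of_pos h0]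
    rw [← abs_mul, mul_sub, abs_div, mul_div_cancel₀ _ h0.ne',
      ← abs_mul]
  rw [h1]
  refine (abs_sub_pow_le_abs_pow_sub (abs_nonneg _) (abs_nonneg _) hk).trans ?_
  rw [← abs_pow, ← abs_pow, mul_pow, mul_pow]
  exact abs_abs_sub_abs_le _ _

lemma pow_le_max_wedge {s k : ℕ} (hk : k ≠ 0) (x y : Fin s → ℝ) (i j : Fin s) (hj : x j ≠ 0)
    {h T f v : ℝ} (hh : 0 < h) (hT : 1 ≤ T) (hf : (h / T) ^ k ≤ f) (hv : |y i - v| ≤ h) :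
    (|x j| / (2 * T) * max h |(|v| - |x i * y j / x j|)|) ^ k ≤
      max (wedge (fun i => x i ^ k) (fun i => y i ^ k)) (f * |x j ^ k|) := by
  set c := |x i * y j / x j|
  have h0 : 0 < |x j| := abs_pos.2 hj
  have hT0 : 0 < T := by linarith
  have h1 : max h |(|v| - c)| ≤ 2 * T * max |(|y i| - c)| (h / T) := by
    have h2 : |(|v| - c)| ≤ |(|y i| - c)| + h := by
      have : |v| - c = (|y i| - c) - (|y i| - |v|) := by ring
      rw [this]
      refine (abs_sub _ _).trans ?_
      gcongr
      exact (abs_abs_sub_abs_le _ _).trans hv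
    have h3 : h ≤ T * max |(|y i| - c)| (h / T) := by
      calc h = T * (h / T) := by field_simp
        _ ≤ _ := by gcongr; exact le_max_right _ _
    have h4 : |(|y i| - c)| ≤ T * max |(|y i| - c)| (h / T) := by
      calc |(|y i| - c)| ≤ 1 * max |(|y i| - c)| (h / T) := by rw [one_mul]; exact le_max_left _ _
        _ ≤ _ := by gcongr
    apply max_le <;> linarith [abs_nonneg (|y i| - c)]
  calc _ ≤ (|x j| / (2 * T) * (2 * T * max |(|y i| - c)| (h / T))) ^ k := by gcongr
    _ = (|x j| * max |(|y i| - c)| (h / T)) ^ k := by congr 1; field_simp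
    _ ≤ _ := by
      rcases le_total |(|y i| - c)| (h / T) with h5 | h5
      · rw [max_eq_right h5]
        refine le_trans ?_ (le_max_right _ _)
        rw [mul_pow, abs_pow, mul_comm]
        gcongr
      · rw [max_eq_left h5]
        exact (pow_le_wedge_pow hk x y i j hj).trans (le_max_left _ _)

/-- If `M` dominates `(r wᵢ)ᵏ` for each of `n` weights, then `M^(-3/2)` is dominated by a product
of kernels. -/
lemma rpow_le_prod {n k : ℕ} (hn : 0 < n) {M r : ℝ} (hr : 0 < r) {w : Fin n → ℝ}
    (hw : ∀ i, 0 < w i) (hM : ∀ i, (r * w i) ^ k ≤ M) :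
    M ^ (-(3 / 2) : ℝ) ≤ r ^ (-(3 * k / 2) : ℝ) * ∏ i, w i ^ (-(3 * k / (2 * n)) : ℝ) := by
  have hn' : (n : ℝ) ≠ 0 := by positivity
  have hM0 : 0 < M := lt_of_lt_of_le (by have := hw ⟨0, hn⟩; positivity) (hM ⟨0, hn⟩)
  calc M ^ (-(3 / 2) : ℝ) = ∏ _i : Fin n, M ^ (-(3 / (2 * n)) : ℝ) := by
        rw [Finset.prod_const, Finset.card_univ, Fintype.card_fin, ← Real.rpow_natCast,
          ← Real.rpow_mul hM0.le]
        congr 1; field_simp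
    _ ≤ ∏ i, r ^ (-(3 * k / (2 * n)) : ℝ) * w i ^ (-(3 * k / (2 * n)) : ℝ) := by
        refine Finset.prod_le_prod (fun i _ => by positivity) fun i _ => ?_
        have hwi := hw i
        rw [← Real.mul_rpow hr.le hwi.le]
        refine (Real.rpow_le_rpow_of_nonpos (by positivity) (hM i) ?_).trans (le_of_eq ?_)
        · rw [neg_nonpos]; positivity
        · rw [← Real.rpow_natCast, ← Real.rpow_mul (by positivity)]
          congr 1; ring
    _ = _ := by
        rw [Finset.prod_mul_distrib, Finset.prod_const, Finset.card_univ, Fintype.card_fin,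
          ← Real.rpow_natCast, ← Real.rpow_mul hr.le]
        congr 2; field_simp

/-- The difference between the normalised slab measure and its regularised main term. -/
noncomputable def slabError {s : ℕ} (e f d : ℝ) (X Y : Fin s → ℝ) : ℝ :=
  |slabMeasure e f X Y / (4 * e * f) - 1 / (2 * Real.pi * max (wedge X Y) d)|

lemma sum_sq_pow_le {s k : ℕ} {x : Fin s → ℝ} (hx : ∀ i, |x i| ≤ 1) :
    ∑ i, (x i ^ k) ^ 2 ≤ s := by
  calc ∑ i, (x i ^ k) ^ 2 ≤ ∑ _i : Fin s, (1 : ℝ) := by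
        refine Finset.sum_le_sum fun i _ => ?_
        rw [← sq_abs, abs_pow, ← pow_mul]
        exact pow_le_one₀ (abs_nonneg _) (hx i)
    _ = s := by simp

lemma slabError_le {n k : ℕ} (hk : k ≠ 0) (hn : 0 < n) {x y v : Fin (n + 1) → ℝ}
    (hx : ∀ i, |x i| ≤ 1) (hy : ∀ i, |y i| ≤ 1) {h T e f : ℝ} (hh : 0 < h) (hh1 : h ≤ 1)
    (hT : 1 ≤ T) (he : (h / T) ^ k ≤ e) (he' : e ≤ h ^ k) (hf : (h / T) ^ k ≤ f)
    (hf' : f ≤ h ^ k) (hv : ∀ i, |y i - v i| ≤ h) (j : Fin (n + 1)) (hj : x j ≠ 0) :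
    slabError e f (h ^ (1 / 4 : ℝ)) (fun i => x i ^ k) (fun i => y i ^ k) ≤
      h ^ (1 / 8 : ℝ) * (4 * (n + 1) + (|x j| / (2 * T)) ^ (-(3 * k / 2) : ℝ) *
        ∏ i, (max h |(|v (j.succAbove i)| - |x (j.succAbove i) * y j / x j|)|) ^
          (-(3 * k / (2 * n)) : ℝ)) := by
  have hT0 : 0 < T := by linarith
  have hhT : 0 < (h / T) ^ k := by positivity
  have he0 : 0 < e := hhT.trans_le he
  have hf0 : 0 < f := hhT.trans_le hf
  have hxj : 0 < |x j| := abs_pos.2 hj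
  have hd : 0 < h ^ (1 / 4 : ℝ) := by positivity
  have hhk : h ^ k ≤ h := pow_le_of_le_one hh.le hh1 hk
  have hhd : h ≤ h ^ (1 / 4 : ℝ) := by
    conv_lhs => rw [← Real.rpow_one h]
    exact Real.rpow_le_rpow_of_exponent_ge hh hh1 (by norm_num)
  have hw : ∀ i, 0 < max h |(|v (j.succAbove i)| - |x (j.succAbove i) * y j / x j|)| :=
    fun i => lt_max_of_lt_left hh
  have hr : 0 < |x j| / (2 * T) := by positivity
  have hP : 0 ≤ (|x j| / (2 * T)) ^ (-(3 * k / 2) : ℝ) *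
        ∏ i, (max h |(|v (j.succAbove i)| - |x (j.succAbove i) * y j / x j|)|) ^
          (-(3 * k / (2 * n)) : ℝ) :=
    mul_nonneg (by positivity) (Finset.prod_nonneg fun i _ => Real.rpow_nonneg (hw i).le _)
  set P := (|x j| / (2 * T)) ^ (-(3 * k / 2) : ℝ) *
        ∏ i, (max h |(|v (j.succAbove i)| - |x (j.succAbove i) * y j / x j|)|) ^
          (-(3 * k / (2 * n)) : ℝ) with hPdef
  unfold slabError
  rcases le_or_gt (h ^ (1 / 4 : ℝ)) (wedge (fun i => x i ^ k) (fun i => y i ^ k)) with hD | hD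
  · have hB : 0 < √((n + 1 : ℕ) : ℝ) := by positivity
    refine (abs_slabMeasure_div_sub_le he0 hf0 he' hf' hd _ _ hD hB ?_ ?_).trans ?_
    · rw [Real.sq_sqrt (by positivity)]; exact sum_sq_pow_le hx
    · rw [Real.sq_sqrt (by positivity)]; exact sum_sq_pow_le hy
    · rw [Real.sq_sqrt (by positivity), div_le_iff₀ (by positivity)]
      have h1 : (h ^ k) ^ 2 ≤ h ^ (1 / 8 : ℝ) * (h ^ (1 / 4 : ℝ)) ^ 3 := by
        have h2 : h ^ (1 / 8 : ℝ) * (h ^ (1 / 4 : ℝ)) ^ 3 = h ^ (7 / 8 : ℝ) := by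
          rw [← Real.rpow_natCast, ← Real.rpow_mul hh.le, ← Real.rpow_add hh]; norm_num
        rw [h2]
        calc (h ^ k) ^ 2 ≤ h ^ 2 := by gcongr
          _ ≤ h := pow_le_of_le_one hh.le hh1 two_ne_zero
          _ = h ^ (1 : ℝ) := (Real.rpow_one h).symm
          _ ≤ _ := Real.rpow_le_rpow_of_exponent_ge hh hh1 (by norm_num)
      push_cast
      calc 4 * ((n : ℝ) + 1) * (h ^ k) ^ 2
          ≤ 4 * ((n : ℝ) + 1) * (h ^ (1 / 8 : ℝ) * (h ^ (1 / 4 : ℝ)) ^ 3) := by gcongr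
        _ = h ^ (1 / 8 : ℝ) * (4 * (n + 1)) * (h ^ (1 / 4 : ℝ)) ^ 3 := by ring
        _ ≤ _ := by gcongr; linarith
  · have hxk : 0 < |x j ^ k| := abs_pos.2 (pow_ne_zero _ hj)
    have hfd : f * |x j ^ k| ≤ h ^ (1 / 4 : ℝ) := by
      have : |x j ^ k| ≤ 1 := by rw [abs_pow]; exact pow_le_one₀ (abs_nonneg _) (hx j)
      nlinarith
    refine (abs_slabMeasure_div_sub_le_small he0 hf0 hd _ _ hD j hxk hfd).trans ?_
    have hM0 : 0 < max (wedge (fun i => x i ^ k) (fun i => y i ^ k)) (f * |x j ^ k|) :=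
      lt_max_of_lt_right (by positivity)
    have hMd : max (wedge (fun i => x i ^ k) (fun i => y i ^ k)) (f * |x j ^ k|)
        ≤ h ^ (1 / 4 : ℝ) := max_le hD.le hfd
    have h1 := rpow_le_prod (M := max (wedge (fun i => x i ^ k) (fun i => y i ^ k))
      (f * |x j ^ k|)) hn hr hw (k := k) fun i =>
        pow_le_max_wedge hk x y (j.succAbove i) j hj hh hT hf (hv _)
    rw [← hPdef] at h1
    set M := max (wedge (fun i => x i ^ k) (fun i => y i ^ k)) (f * |x j ^ k|)
    calc 1 / M = M ^ (1 / 2 : ℝ) * M ^ (-(3 / 2) : ℝ) := by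
          rw [← Real.rpow_add hM0, one_div, ← Real.rpow_neg_one]; norm_num
      _ ≤ (h ^ (1 / 4 : ℝ)) ^ (1 / 2 : ℝ) * P := by gcongr
      _ = h ^ (1 / 8 : ℝ) * P := by rw [← Real.rpow_mul hh.le]; norm_num
      _ ≤ _ := by gcongr; nlinarith

lemma lintegral_cubeVol_prod_singKernel_le : ∃ C : ENNReal, C ≠ ⊤ ∧ 1 ≤ C ∧
    ∀ (n : ℕ) (a h : ℝ) (c : Fin n → ℝ), 0 ≤ a → a ≤ 3 / 4 → 0 < h →
      ∫⁻ w, ∏ i, singKernel a h |(|w i| - c i)| ∂cubeVol n ≤ C ^ n := by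
  obtain ⟨C, hC, hC1, hb⟩ := exists_lintegral_singKernel_le
  refine ⟨C, hC, hC1, fun n a h c ha ha' hh => ?_⟩
  have hm := measurable_singKernel a h
  rw [lintegral_cubeVol_prod (fun i t => singKernel a h |(|t| - c i)|) fun i => by fun_prop]
  calc _ ≤ ∏ _i : Fin n, C := Finset.prod_le_prod' fun i _ => hb a h (c i) ha ha' hh
    _ = C ^ n := by simp

/-- A measurable approximation of the identity on `[-1, 1)` with error `h`. -/
structure ApproxId (h : ℝ) (g : ℝ → ℝ) : Prop where
  meas : Measurable g
  abs_le_one : ∀ t ∈ Set.Ico (-1 : ℝ) 1, |g t| ≤ 1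
  abs_sub_le : ∀ t ∈ Set.Ico (-1 : ℝ) 1, |g t - t| ≤ h

lemma lintegral_slabError_le (n : ℕ) : ∃ C : ENNReal, C ≠ ⊤ ∧ 1 ≤ C ∧
    ∀ (k : ℕ) (_ : k ≠ 0) (_ : 2 * k ≤ n) (x : Fin (n + 1) → ℝ) (_ : ∀ i, |x i| ≤ 1)
    (h T e f : ℝ) (_ : 0 < h) (_ : h ≤ 1) (_ : 1 ≤ T) (_ : (h / T) ^ k ≤ e) (_ : e ≤ h ^ k)
    (_ : (h / T) ^ k ≤ f) (_ : f ≤ h ^ k) (g : ℝ → ℝ) (_ : ApproxId h g)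
    (j : Fin (n + 1)) (_ : x j ≠ 0),
    ∫⁻ v, ENNReal.ofReal (slabError e f (h ^ (1 / 4 : ℝ)) (fun i => x i ^ k)
      (fun i => g (v i) ^ k)) ∂cubeVol (n + 1) ≤
      C * ENNReal.ofReal (h ^ (1 / 8 : ℝ) * (1 + (|x j| / (2 * T)) ^ (-(3 * k / 2) : ℝ))) := by
  obtain ⟨C, hC, hC1, hb⟩ := lintegral_cubeVol_prod_singKernel_le
  refine ⟨4 * (n + 1) * 2 ^ (n + 1) + 2 * C ^ n, by finiteness, ?_, ?_⟩
  · refine le_trans ?_ le_add_self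
    calc (1 : ENNReal) = 1 * 1 ^ n := by simp
      _ ≤ 2 * C ^ n := by gcongr; norm_num
  intro k hk hkn x hx h T e f hh hh1 hT he he' hf hf' g hg j hj
  have hn : 0 < n := by omega
  have hgm := hg.meas
  set a : ℝ := 3 * k / (2 * n) with ha
  have ha0 : 0 ≤ a := by positivity
  have ha1 : a ≤ 3 / 4 := by
    rw [ha, div_le_div_iff₀ (by positivity) (by norm_num)]
    have : (2 * k : ℝ) ≤ n := by exact_mod_cast hkn
    linarith
  have hm := measurable_singKernel a h
  set r := (|x j| / (2 * T)) ^ (-(3 * k / 2) : ℝ) with hr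
  have hr0 : 0 ≤ r := by positivity
  set q := h ^ (1 / 8 : ℝ) with hq
  have hq0 : 0 ≤ q := by positivity
  have hpt : ∀ᵐ v ∂cubeVol (n + 1), ENNReal.ofReal (slabError e f (h ^ (1 / 4 : ℝ))
      (fun i => x i ^ k) (fun i => g (v i) ^ k)) ≤
      ENNReal.ofReal (q * (4 * (n + 1))) + ENNReal.ofReal (q * r) *
      ∏ i : Fin n, singKernel a h |(|v (j.succAbove i)| - |x (j.succAbove i) * g (v j) / x j|)| := by
    filter_upwards [ae_cubeVol (n + 1)] with v hv
    have h1 := slabError_le hk hn hx (fun i => hg.abs_le_one _ (hv i)) hh hh1 hT he he' hf hf'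
      (fun i => hg.abs_sub_le _ (hv i)) j hj
    refine (ENNReal.ofReal_le_ofReal h1).trans (le_of_eq ?_)
    have h2 : ∀ i, 0 ≤ (max h |(|v (j.succAbove i)| - |x (j.succAbove i) * g (v j) / x j|)|) ^
        (-a) := fun i => Real.rpow_nonneg (le_max_of_le_left hh.le) _
    unfold singKernel
    rw [← ENNReal.ofReal_prod_of_nonneg (fun i _ => h2 i), ← ENNReal.ofReal_mul (by positivity),
      ← ENNReal.ofReal_add (by positivity)
        (mul_nonneg (by positivity) (Finset.prod_nonneg fun i _ => h2 i))]
    congr 1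
    ring
  have hI : ∫⁻ v, ∏ i : Fin n, singKernel a h
      |(|v (j.succAbove i)| - |x (j.succAbove i) * g (v j) / x j|)| ∂cubeVol (n + 1) ≤ 2 * C ^ n := by
    rw [lintegral_cubeVol_succAbove j (by fun_prop)]
    simp only [Fin.insertNth_apply_succAbove, Fin.insertNth_apply_same]
    calc _ ≤ ∫⁻ _t, C ^ n ∂cubeLine := lintegral_mono fun t => hb n a h _ ha0 ha1 hh
      _ = 2 * C ^ n := by rw [lintegral_const, cubeLine_univ, mul_comm]
  calc _ ≤ _ := lintegral_mono_ae hpt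
    _ = ENNReal.ofReal (q * (4 * (n + 1))) * 2 ^ (n + 1) + ENNReal.ofReal (q * r) *
      ∫⁻ v, ∏ i : Fin n, singKernel a h
      |(|v (j.succAbove i)| - |x (j.succAbove i) * g (v j) / x j|)| ∂cubeVol (n + 1) := by
        rw [lintegral_add_left measurable_const, lintegral_const, cubeVol_univ,
          lintegral_const_mul _ (by fun_prop)]
    _ ≤ ENNReal.ofReal (q * (4 * (n + 1))) * 2 ^ (n + 1) + ENNReal.ofReal (q * r) *
      (2 * C ^ n) := by gcongr
    _ = 4 * (n + 1) * 2 ^ (n + 1) * ENNReal.ofReal (q * 1) +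
        2 * C ^ n * ENNReal.ofReal (q * r) := by
        rw [ENNReal.ofReal_mul hq0, mul_one, ENNReal.ofReal_mul (by norm_num),
          ENNReal.ofReal_add (by positivity) (by norm_num)]
        simp
        ring
    _ ≤ 4 * (n + 1) * 2 ^ (n + 1) * ENNReal.ofReal (q * (1 + r)) +
        2 * C ^ n * ENNReal.ofReal (q * (1 + r)) := by
        gcongr <;> linarith
    _ = _ := by ring

lemma cubeVol_small_le (s : ℕ) (h : ℝ) :
    cubeVol s {u | ∀ i, |u i| < 2 * h} ≤ ENNReal.ofReal (4 * h) ^ s := by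
  have : {u : Fin s → ℝ | ∀ i, |u i| < 2 * h} = Set.univ.pi fun _ => Set.Ioo (-(2 * h)) (2 * h) := by
    ext u; simp [abs_lt]
  rw [this, cubeVol, Measure.pi_pi, Finset.prod_const, Finset.card_univ, Fintype.card_fin]
  gcongr
  refine (Measure.restrict_apply_le _ _).trans ?_
  rw [Real.volume_Ioo]
  exact ENNReal.ofReal_le_ofReal (by linarith)

lemma lintegral_lintegral_slabError_le (n k : ℕ) (hk : k ≠ 0) (hkn : 2 * k ≤ n) :
    ∃ C : ENNReal, C ≠ ⊤ ∧
    ∀ (h T e f : ℝ) (_ : 0 < h) (_ : h ≤ 1) (_ : 1 ≤ T) (_ : (h / T) ^ k ≤ e) (_ : e ≤ h ^ k)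
    (_ : (h / T) ^ k ≤ f) (_ : f ≤ h ^ k) (g g' : ℝ → ℝ) (_ : ApproxId h g) (_ : ApproxId h g'),
    ∫⁻ u, ∫⁻ v, ENNReal.ofReal (slabError e f (h ^ (1 / 4 : ℝ)) (fun i => g (u i) ^ k)
      (fun i => g' (v i) ^ k)) ∂cubeVol (n + 1) ∂cubeVol (n + 1) ≤
      C * ENNReal.ofReal (T ^ (2 * k) * h ^ (1 / 8 : ℝ)) := by
  obtain ⟨C, hC, hC1, hb⟩ := lintegral_slabError_le n
  obtain ⟨C', hC', hC1', hb'⟩ := lintegral_cubeVol_prod_singKernel_le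
  refine ⟨C * 2 ^ (n + 1) + C * 4 ^ (2 * k) * C' ^ (n + 1) + 2 * 8 ^ (n + 1), by finiteness, ?_⟩
  intro h T e f hh hh1 hT he he' hf hf' g g' hg hg'
  have hT0 : 0 < T := by linarith
  have hhT : 0 < (h / T) ^ k := by positivity
  have he0 : 0 < e := hhT.trans_le he
  have hf0 : 0 < f := hhT.trans_le hf
  have hd : 0 < h ^ (1 / 4 : ℝ) := by positivity
  set q := h ^ (1 / 8 : ℝ) with hq
  have hq0 : 0 ≤ q := by positivity
  set a : ℝ := 3 * k / (2 * (n + 1 : ℕ)) with ha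
  have ha0 : 0 ≤ a := by positivity
  have ha1 : a ≤ 3 / 4 := by
    rw [ha, div_le_div_iff₀ (by positivity) (by norm_num)]
    have : (2 * k : ℝ) ≤ n := by exact_mod_cast hkn
    push_cast
    linarith
  have hm := measurable_singKernel a h
  set Sm : Set (Fin (n + 1) → ℝ) := {u | ∀ i, |u i| < 2 * h} with hSm
  have hSmm : MeasurableSet Sm := by
    rw [hSm, Set.ofPred_forall]
    exact MeasurableSet.iInter fun i => measurableSet_lt (by fun_prop) (by fun_prop)
  set κ : ENNReal := ENNReal.ofReal (1 / (4 * e * f) + 1 / h ^ (1 / 4 : ℝ)) * 2 ^ (n + 1) with hκ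
  have hpt : ∀ᵐ u ∂cubeVol (n + 1), ∫⁻ v, ENNReal.ofReal (slabError e f (h ^ (1 / 4 : ℝ))
      (fun i => g (u i) ^ k) (fun i => g' (v i) ^ k)) ∂cubeVol (n + 1) ≤
      (C * ENNReal.ofReal q + C * ENNReal.ofReal (q * (4 * T) ^ (2 * k)) *
        ∏ i, singKernel a h |(|u i| - 0)|) + Sm.indicator (fun _ => κ) u := by
    filter_upwards [ae_cubeVol (n + 1)] with u hu
    by_cases hS : u ∈ Sm
    · rw [Set.indicator_of_mem hS]
      refine le_trans ?_ le_add_self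
      calc _ ≤ ∫⁻ _v : Fin (n + 1) → ℝ, ENNReal.ofReal (1 / (4 * e * f) + 1 / h ^ (1 / 4 : ℝ))
              ∂cubeVol (n + 1) := lintegral_mono fun v => ENNReal.ofReal_le_ofReal
                (abs_slabMeasure_div_sub_le_trivial he0 hf0 hd _ _)
        _ = κ := by rw [lintegral_const, cubeVol_univ]
    · rw [Set.indicator_of_notMem hS, add_zero]
      obtain ⟨j, hj⟩ := Finite.exists_max fun i => |u i|
      have hj2 : 2 * h ≤ |u j| := by
        simp only [hSm, Set.mem_ofPred_eq, not_forall, not_lt] at hS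
        obtain ⟨i, hi⟩ := hS
        exact hi.trans (hj i)
      have hgj : |u j| / 2 ≤ |g (u j)| := by
        have h1 := hg.abs_sub_le _ (hu j)
        have h2 := abs_abs_sub_abs_le (g (u j)) (u j)
        have h3 := (abs_le.1 (h2.trans h1)).1
        linarith
      have huj : 0 < |u j| := by linarith
      have hgj0 : g (u j) ≠ 0 := abs_pos.1 (by linarith)
      refine (hb k hk hkn (fun i => g (u i)) (fun i => hg.abs_le_one _ (hu i)) h T e f hh hh1 hT
        he he' hf hf' g' hg' j hgj0).trans ?_
      have hw : ∀ i, 0 < max h |u i| := fun i => lt_max_of_lt_left hh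
      have h4 := rpow_le_prod (n := n + 1) (k := k) (M := |u j| ^ k) (by omega) one_pos hw
        fun i => by
          rw [one_mul]
          have : max h |u i| ≤ |u j| := max_le (by linarith) (hj i)
          have := (hw i).le
          gcongr
      have h5 : (|g (u j)| / (2 * T)) ^ (-(3 * k / 2) : ℝ) ≤
          (4 * T) ^ (2 * k) * ∏ i, (max h |u i|) ^ (-a) := by
        have hexp : (-(3 * k / 2) : ℝ) ≤ 0 := by rw [neg_nonpos]; positivity
        calc (|g (u j)| / (2 * T)) ^ (-(3 * k / 2) : ℝ)
            ≤ (|u j| / (4 * T)) ^ (-(3 * k / 2) : ℝ) := by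
              refine Real.rpow_le_rpow_of_nonpos (by positivity) ?_ hexp
              rw [div_le_div_iff₀ (by positivity) (by positivity)]
              nlinarith
          _ = (4 * T) ^ (3 * k / 2 : ℝ) * (|u j| ^ k) ^ (-(3 / 2) : ℝ) := by
              rw [Real.div_rpow huj.le (by positivity), Real.rpow_neg (by positivity) (3 * k / 2),
                Real.rpow_neg (by positivity) (3 * k / 2), ← Real.rpow_natCast,
                ← Real.rpow_mul huj.le, show (k : ℝ) * (-(3 / 2)) = -(3 * k / 2) by ring,
                Real.rpow_neg huj.le]
              field_simp
          _ ≤ (4 * T) ^ (2 * k) * (1 ^ (-(3 * k / 2) : ℝ) * ∏ i, (max h |u i|) ^ (-a)) := by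
              gcongr
              rw [← Real.rpow_natCast]
              apply Real.rpow_le_rpow_of_exponent_le (by linarith)
              push_cast
              nlinarith [(Nat.cast_nonneg k : (0 : ℝ) ≤ k)]
          _ = _ := by rw [Real.one_rpow, one_mul]
      have h6 : ∀ i, 0 ≤ (max h |u i|) ^ (-a) := fun i => Real.rpow_nonneg (hw i).le _
      have h7 : ∏ i, singKernel a h |(|u i| - 0)| = ENNReal.ofReal (∏ i, (max h |u i|) ^ (-a)) := by
        rw [ENNReal.ofReal_prod_of_nonneg fun i _ => h6 i]
        simp [singKernel]
      rw [h7, mul_assoc, ← mul_add, ← ENNReal.ofReal_mul (by positivity),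
        ← ENNReal.ofReal_add hq0 (mul_nonneg (by positivity) (Finset.prod_nonneg fun i _ => h6 i))]
      gcongr
      rw [mul_add, mul_one, mul_assoc]
      gcongr
  have hprod := hb' (n + 1) a h (fun _ => 0) ha0 ha1 hh
  have hTk : 1 ≤ T ^ (2 * k) := one_le_pow₀ hT
  have hκS : κ * cubeVol (n + 1) Sm ≤
      2 * 8 ^ (n + 1) * ENNReal.ofReal (T ^ (2 * k) * q) := by
    have h1 : 1 / (4 * e * f) + 1 / h ^ (1 / 4 : ℝ) ≤ 2 * T ^ (2 * k) / h ^ (2 * k) := by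
      have h2 : 1 / (4 * e * f) ≤ T ^ (2 * k) / h ^ (2 * k) := by
        rw [div_le_div_iff₀ (by positivity) (by positivity), one_mul]
        have h3 : (h / T) ^ k * (h / T) ^ k ≤ e * f := mul_le_mul he hf hhT.le he0.le
        have h4 : h ^ (2 * k) = T ^ (2 * k) * ((h / T) ^ k * (h / T) ^ k) := by
          rw [← pow_add, ← two_mul, ← mul_pow]; congr 1; field_simp
        rw [h4]
        have : 0 < T ^ (2 * k) := by positivity
        have : 0 < e * f := by positivity
        nlinarith
      have h3 : 1 / h ^ (1 / 4 : ℝ) ≤ T ^ (2 * k) / h ^ (2 * k) := by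
        refine (one_div_le_one_div_of_le (by positivity) ?_).trans
          (div_le_div_of_nonneg_right hTk (by positivity))
        rw [← Real.rpow_natCast]
        apply Real.rpow_le_rpow_of_exponent_ge hh hh1
        have : 1 ≤ k := Nat.one_le_iff_ne_zero.2 hk
        have : (1 : ℝ) ≤ k := by exact_mod_cast this
        push_cast
        linarith
      rw [mul_div_assoc]; linarith
    have h2 : 2 * T ^ (2 * k) / h ^ (2 * k) * (4 * h) ^ (n + 1) ≤
        2 * 4 ^ (n + 1) * (T ^ (2 * k) * q) := by
      have h3 : h ^ (n + 1) ≤ h ^ (2 * k) * q := by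
        calc h ^ (n + 1) ≤ h ^ (2 * k + 1) := pow_le_pow_of_le_one hh.le hh1 (by omega)
          _ = h ^ (2 * k) * h ^ (1 : ℝ) := by rw [pow_succ, Real.rpow_one]
          _ ≤ _ := by
            gcongr
            exact Real.rpow_le_rpow_of_exponent_ge hh hh1 (by norm_num)
      rw [mul_pow]
      calc _ ≤ 2 * T ^ (2 * k) / h ^ (2 * k) * (4 ^ (n + 1) * (h ^ (2 * k) * q)) := by gcongr
        _ = _ := by field_simp
    calc κ * cubeVol (n + 1) Sm
        ≤ ENNReal.ofReal (2 * T ^ (2 * k) / h ^ (2 * k)) * 2 ^ (n + 1) *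
          ENNReal.ofReal (4 * h) ^ (n + 1) := by
          refine mul_le_mul' ?_ (cubeVol_small_le _ _)
          rw [hκ]
          gcongr
      _ = 2 ^ (n + 1) * ENNReal.ofReal (2 * T ^ (2 * k) / h ^ (2 * k) * (4 * h) ^ (n + 1)) := by
          rw [ENNReal.ofReal_mul (by positivity) (q := (4 * h) ^ (n + 1)),
            ENNReal.ofReal_pow (by positivity)]
          ring
      _ ≤ 2 ^ (n + 1) * ENNReal.ofReal (2 * 4 ^ (n + 1) * (T ^ (2 * k) * q)) := by gcongr
      _ = _ := by
          rw [ENNReal.ofReal_mul (by positivity), show (8 : ENNReal) = 2 * 4 by norm_num, mul_pow,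
            ENNReal.ofReal_mul (by positivity), ENNReal.ofReal_pow (by positivity)]
          simp
          ring
  calc _ ≤ _ := lintegral_mono_ae hpt
    _ = C * ENNReal.ofReal q * 2 ^ (n + 1) + C * ENNReal.ofReal (q * (4 * T) ^ (2 * k)) *
        ∫⁻ u, ∏ i, singKernel a h |(|u i| - 0)| ∂cubeVol (n + 1) + κ * cubeVol (n + 1) Sm := by
        rw [lintegral_add_left (by fun_prop), lintegral_add_left measurable_const, lintegral_const,
          cubeVol_univ, lintegral_const_mul _ (by fun_prop), lintegral_indicator_const hSmm]
    _ ≤ C * ENNReal.ofReal (T ^ (2 * k) * q) * 2 ^ (n + 1) +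
        C * ENNReal.ofReal (4 ^ (2 * k) * (T ^ (2 * k) * q)) * C' ^ (n + 1) +
        2 * 8 ^ (n + 1) * ENNReal.ofReal (T ^ (2 * k) * q) := by
        gcongr ?_ + ?_ + ?_
        · gcongr
          nlinarith
        · gcongr C * ENNReal.ofReal ?_ * ?_
          · rw [mul_pow]; apply le_of_eq; ring
    _ = _ := by
        rw [ENNReal.ofReal_mul (by positivity) (p := 4 ^ (2 * k)),
          ENNReal.ofReal_pow (by positivity)]
        simp
        ring

/-- The normalised volume of the set where the form `∑ lᵢ g(vᵢ)ᵏ` is small. -/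
noncomputable def normVol (k s : ℕ) (e : ℝ) (g : ℝ → ℝ) (l : Fin s → ℝ) : ℝ :=
  (cubeVol s).real {v | |∑ i, l i * g (v i) ^ k| < e} / (2 * e)

/-- The regularised main term of the second moment of `normVol`. -/
noncomputable def mainTerm (k s : ℕ) (d : ℝ) : ℝ :=
  ∫ p : (Fin s → ℝ) × (Fin s → ℝ),
    1 / (2 * Real.pi * max (wedge (fun i => p.1 i ^ k) (fun i => p.2 i ^ k)) d)
    ∂(cubeVol s).prod (cubeVol s)

lemma measurableSet_slab {s k : ℕ} (e : ℝ) {g : ℝ → ℝ} (hg : Measurable g) :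
    MeasurableSet {z : (Fin s → ℝ) × (Fin s → ℝ) | |∑ i, z.1 i * g (z.2 i) ^ k| < e} :=
  measurableSet_lt (by fun_prop) (by fun_prop)

lemma measurable_normVol {k s : ℕ} (e : ℝ) {g : ℝ → ℝ} (hg : Measurable g) :
    Measurable (normVol k s e g) := by
  unfold normVol
  refine Measurable.div_const ?_ _
  exact (measurable_measure_prodMk_left (measurableSet_slab (k := k) e hg)).ennreal_toReal

lemma normVol_nonneg {k s : ℕ} {e : ℝ} (he : 0 < e) (g : ℝ → ℝ) (l : Fin s → ℝ) :
    0 ≤ normVol k s e g l := by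
  unfold normVol; positivity

lemma normVol_le {k s : ℕ} {e : ℝ} (he : 0 < e) (g : ℝ → ℝ) (l : Fin s → ℝ) :
    normVol k s e g l ≤ (cubeVol s).real Set.univ / (2 * e) := by
  unfold normVol
  gcongr
  · exact measure_ne_top _ _
  · exact Set.subset_univ _

lemma integrable_normVol_mul {k s : ℕ} {e f : ℝ} (he : 0 < e) (hf : 0 < f) {g g' : ℝ → ℝ}
    (hg : Measurable g) (hg' : Measurable g') :
    Integrable (fun l => normVol k s e g l * normVol k s f g' l) (gaussianPi s) := by
  refine Integrable.of_bound
    ((measurable_normVol e hg).mul (measurable_normVol f hg')).aestronglyMeasurable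
    ((cubeVol s).real Set.univ / (2 * e) * ((cubeVol s).real Set.univ / (2 * f))) ?_
  filter_upwards with l
  have h1 := normVol_nonneg (k := k) he g l
  have h2 := normVol_nonneg (k := k) hf g' l
  rw [Real.norm_of_nonneg (by positivity)]
  gcongr
  · exact normVol_le he g l
  · exact normVol_le hf g' l

lemma measurable_slabMeasure {s : ℕ} (e f : ℝ) {Ω : Type*} [MeasurableSpace Ω]
    {x y : Ω → Fin s → ℝ} (hx : Measurable x) (hy : Measurable y) :
    Measurable fun p => slabMeasure e f (x p) (y p) := by
  unfold slabMeasure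
  refine Measurable.ennreal_toReal ?_
  refine measurable_measure_prodMk_left
    (s := {z : Ω × (Fin s → ℝ) | |∑ i, z.2 i * x z.1 i| < e ∧ |∑ i, z.2 i * y z.1 i| < f}) ?_
  exact (measurableSet_lt (f := fun z : Ω × (Fin s → ℝ) => |∑ i, z.2 i * x z.1 i|)
    (by fun_prop) measurable_const).inter
    (measurableSet_lt (f := fun z : Ω × (Fin s → ℝ) => |∑ i, z.2 i * y z.1 i|)
    (by fun_prop) measurable_const)

lemma measurable_wedge {s : ℕ} {Ω : Type*} [MeasurableSpace Ω]
    {x y : Ω → Fin s → ℝ} (hx : Measurable x) (hy : Measurable y) :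
    Measurable fun p => wedge (x p) (y p) := by
  unfold wedge
  fun_prop

lemma integral_normVol_mul {k s : ℕ} (e f : ℝ) {g g' : ℝ → ℝ}
    (hg : Measurable g) (hg' : Measurable g') :
    ∫ l, normVol k s e g l * normVol k s f g' l ∂gaussianPi s =
      ∫ p : (Fin s → ℝ) × (Fin s → ℝ), slabMeasure e f (fun i => g (p.1 i) ^ k)
        (fun i => g' (p.2 i) ^ k) / (4 * e * f) ∂(cubeVol s).prod (cubeVol s) := by
  set W : Set ((Fin s → ℝ) × ((Fin s → ℝ) × (Fin s → ℝ))) :=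
    {z | |∑ i, z.1 i * g (z.2.1 i) ^ k| < e ∧ |∑ i, z.1 i * g' (z.2.2 i) ^ k| < f} with hW
  have hWm : MeasurableSet W :=
    (measurableSet_lt (f := fun z : (Fin s → ℝ) × ((Fin s → ℝ) × (Fin s → ℝ)) =>
      |∑ i, z.1 i * g (z.2.1 i) ^ k|) (by fun_prop) measurable_const).inter
    (measurableSet_lt (f := fun z : (Fin s → ℝ) × ((Fin s → ℝ) × (Fin s → ℝ)) =>
      |∑ i, z.1 i * g' (z.2.2 i) ^ k|) (by fun_prop) measurable_const)
  have h1 := Measure.prod_apply (μ := gaussianPi s) (ν := (cubeVol s).prod (cubeVol s)) hWm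
  have h2 := Measure.prod_apply_symm (μ := gaussianPi s) (ν := (cubeVol s).prod (cubeVol s)) hWm
  have h3 : ∫ l, ((cubeVol s).prod (cubeVol s)).real (Prod.mk l ⁻¹' W) ∂gaussianPi s =
      ∫ p, (gaussianPi s).real ((fun l => (l, p)) ⁻¹' W) ∂(cubeVol s).prod (cubeVol s) := by
    unfold Measure.real
    rw [integral_toReal, integral_toReal, ← h1, ← h2]
    · exact (measurable_measure_prodMk_right hWm).aemeasurable
    · filter_upwards with p using measure_lt_top _ _
    · exact (measurable_measure_prodMk_left hWm).aemeasurable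
    · filter_upwards with p using measure_lt_top _ _
  have h4 : ∀ l, ((cubeVol s).prod (cubeVol s)).real (Prod.mk l ⁻¹' W) =
      (cubeVol s).real {v | |∑ i, l i * g (v i) ^ k| < e} *
      (cubeVol s).real {v | |∑ i, l i * g' (v i) ^ k| < f} := by
    intro l
    rw [← measureReal_prod_prod]
    rfl
  simp_rw [h4] at h3
  have h5 : ∀ l, normVol k s e g l * normVol k s f g' l =
      ((cubeVol s).real {v | |∑ i, l i * g (v i) ^ k| < e} *
      (cubeVol s).real {v | |∑ i, l i * g' (v i) ^ k| < f}) / (4 * e * f) := by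
    intro l; unfold normVol; rw [div_mul_div_comm]; congr 1; ring
  simp_rw [h5]
  rw [integral_div, h3, integral_div]
  rfl

lemma abs_pow_sub_pow_le_mul {a b : ℝ} (ha : |a| ≤ 1) (hb : |b| ≤ 1) (k : ℕ) :
    |a ^ k - b ^ k| ≤ k * |a - b| := by
  have h := abs_pow_sub_pow_le a b k
  have h1 : max |a| |b| ^ (k - 1) ≤ 1 :=
    pow_le_one₀ (le_max_of_le_left (abs_nonneg _)) (max_le ha hb)
  calc _ ≤ |a - b| * k * max |a| |b| ^ (k - 1) := h
    _ ≤ |a - b| * k * 1 := by gcongr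
    _ = _ := by ring

lemma abs_one_div_max_sub_le {D D' d : ℝ} (hd : 0 < d) :
    |1 / (2 * Real.pi * max D d) - 1 / (2 * Real.pi * max D' d)| ≤ |D - D'| / d ^ 2 := by
  have hpi := Real.pi_gt_three
  have h1 : d ≤ max D d := le_max_right _ _
  have h2 : d ≤ max D' d := le_max_right _ _
  have h3 : |max D d - max D' d| ≤ |D - D'| := abs_max_sub_max_le_abs _ _ _
  have h4 : 0 < max D d := by linarith
  have h5 : 0 < max D' d := by linarith
  have h6 : 1 / (2 * Real.pi * max D d) - 1 / (2 * Real.pi * max D' d) =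
      (max D' d - max D d) / (2 * Real.pi * (max D d * max D' d)) := by
    field_simp
  rw [h6, abs_div, abs_sub_comm, abs_of_pos (by positivity : 0 < 2 * Real.pi * (max D d * max D' d))]
  have h7 : d ^ 2 ≤ max D d * max D' d := by nlinarith
  gcongr
  nlinarith [pow_pos hd 2]

lemma abs_integral_normVol_mul_sub_le (n k : ℕ) (hk : k ≠ 0) (hkn : 2 * k ≤ n) :
    ∃ C : ℝ, 0 ≤ C ∧
    ∀ (h T e f : ℝ) (_ : 0 < h) (_ : h ≤ 1) (_ : 1 ≤ T) (_ : (h / T) ^ k ≤ e) (_ : e ≤ h ^ k)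
    (_ : (h / T) ^ k ≤ f) (_ : f ≤ h ^ k) (g g' : ℝ → ℝ) (_ : ApproxId h g) (_ : ApproxId h g'),
    |∫ l, normVol k (n + 1) e g l * normVol k (n + 1) f g' l ∂gaussianPi (n + 1)
      - mainTerm k (n + 1) (h ^ (1 / 4 : ℝ))| ≤ C * (T ^ (2 * k) * h ^ (1 / 8 : ℝ)) := by
  obtain ⟨C, hC, hb⟩ := lintegral_lintegral_slabError_le n k hk hkn
  set K : ℝ := 4 * (n + 1 : ℕ) * k with hK
  refine ⟨(C + ENNReal.ofReal K * (2 ^ (n + 1) * 2 ^ (n + 1))).toReal, ENNReal.toReal_nonneg, ?_⟩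
  intro h T e f hh hh1 hT he he' hf hf' g g' hg hg'
  have hgm := hg.meas
  have hgm' := hg'.meas
  have hT0 : 0 < T := by linarith
  have hhT : 0 < (h / T) ^ k := by positivity
  have he0 : 0 < e := hhT.trans_le he
  have hf0 : 0 < f := hhT.trans_le hf
  set d := h ^ (1 / 4 : ℝ) with hd
  have hd0 : 0 < d := by positivity
  rw [integral_normVol_mul e f hgm hgm', mainTerm, ← integral_sub]
  rotate_left
  · refine Integrable.of_bound (C := 1 / (4 * e * f)) ?_ ?_
    · exact ((measurable_slabMeasure e f (by fun_prop) (by fun_prop)).div_const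
        _).aestronglyMeasurable
    · filter_upwards with p
      have h0 := slabMeasure_nonneg e f (fun i => g (p.1 i) ^ k) (fun i => g' (p.2 i) ^ k)
      rw [Real.norm_of_nonneg (by positivity)]
      gcongr
      exact slabMeasure_le_one _ _ _ _
  · refine Integrable.of_bound (C := 1 / d) ?_ ?_
    · have := measurable_wedge (x := fun p : (Fin (n + 1) → ℝ) × (Fin (n + 1) → ℝ) =>
        fun i => p.1 i ^ k) (y := fun p => fun i => p.2 i ^ k) (by fun_prop) (by fun_prop)
      exact Measurable.aestronglyMeasurable (by fun_prop)
    · filter_upwards with p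
      rw [Real.norm_of_nonneg (one_div_two_pi_max_nonneg hd0)]
      exact one_div_two_pi_max_le hd0
  set q := h ^ (1 / 8 : ℝ) with hq
  have hpt : ∀ᵐ p ∂(cubeVol (n + 1)).prod (cubeVol (n + 1)),
      ‖slabMeasure e f (fun i => g (p.1 i) ^ k) (fun i => g' (p.2 i) ^ k) / (4 * e * f) -
        1 / (2 * Real.pi * max (wedge (fun i => p.1 i ^ k) (fun i => p.2 i ^ k)) d)‖ₑ ≤
      ENNReal.ofReal (slabError e f d (fun i => g (p.1 i) ^ k) (fun i => g' (p.2 i) ^ k)) +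
      ENNReal.ofReal (K * q) := by
    have h1 := (Measure.quasiMeasurePreserving_fst (μ := cubeVol (n + 1))
      (ν := cubeVol (n + 1))).ae (ae_cubeVol (n + 1))
    have h2 := (Measure.quasiMeasurePreserving_snd (μ := cubeVol (n + 1))
      (ν := cubeVol (n + 1))).ae (ae_cubeVol (n + 1))
    filter_upwards [h1, h2] with p hp1 hp2
    have habs : ∀ t ∈ Set.Ico (-1 : ℝ) 1, |t| ≤ 1 := fun t ht => abs_le.2 ⟨ht.1, ht.2.le⟩
    have hpw : ∀ (g : ℝ → ℝ), ApproxId h g → ∀ t ∈ Set.Ico (-1 : ℝ) 1,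
        |g t ^ k - t ^ k| ≤ k * h := fun g hg t ht =>
      (abs_pow_sub_pow_le_mul (hg.abs_le_one t ht) (habs t ht) k).trans (by
        gcongr; exact hg.abs_sub_le t ht)
    have h3 : |wedge (fun i => g (p.1 i) ^ k) (fun i => g' (p.2 i) ^ k) -
        wedge (fun i => p.1 i ^ k) (fun i => p.2 i ^ k)| ≤ 4 * (n + 1 : ℕ) * (k * h) :=
      wedge_sub_wedge_le
        (fun i => by rw [abs_pow]; exact pow_le_one₀ (abs_nonneg _) (hg'.abs_le_one _ (hp2 i)))
        (fun i => by rw [abs_pow]; exact pow_le_one₀ (abs_nonneg _) (habs _ (hp1 i)))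
        (fun i => hpw g hg _ (hp1 i)) (fun i => hpw g' hg' _ (hp2 i))
    have h4 := abs_one_div_max_sub_le (D := wedge (fun i => g (p.1 i) ^ k)
      (fun i => g' (p.2 i) ^ k)) (D' := wedge (fun i => p.1 i ^ k) (fun i => p.2 i ^ k)) hd0
    have h5 : 4 * (n + 1 : ℕ) * (k * h) / d ^ 2 ≤ K * q := by
      rw [div_le_iff₀ (by positivity)]
      have : h ≤ q * d ^ 2 := by
        rw [hq, hd, ← Real.rpow_natCast, ← Real.rpow_mul hh.le, ← Real.rpow_add hh]
        conv_lhs => rw [← Real.rpow_one h]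
        exact Real.rpow_le_rpow_of_exponent_ge hh hh1 (by norm_num)
      calc _ = K * h := by rw [hK]; ring
        _ ≤ K * (q * d ^ 2) := by gcongr
        _ = _ := by ring
    have h6 := h4.trans ((div_le_div_of_nonneg_right h3 (by positivity)).trans h5)
    unfold slabError
    rw [← ENNReal.ofReal_add (abs_nonneg _) (by positivity), Real.enorm_eq_ofReal_abs]
    apply ENNReal.ofReal_le_ofReal
    refine (abs_sub_le _ (1 / (2 * Real.pi * max (wedge (fun i => g (p.1 i) ^ k)
      (fun i => g' (p.2 i) ^ k)) d)) _).trans ?_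
    gcongr
  have hmeas : Measurable fun p : (Fin (n + 1) → ℝ) × (Fin (n + 1) → ℝ) =>
      ENNReal.ofReal (slabError e f d (fun i => g (p.1 i) ^ k) (fun i => g' (p.2 i) ^ k)) := by
    have h1 := measurable_wedge (x := fun p : (Fin (n + 1) → ℝ) × (Fin (n + 1) → ℝ) =>
      fun i => g (p.1 i) ^ k) (y := fun p => fun i => g' (p.2 i) ^ k) (by fun_prop) (by fun_prop)
    have h2 := measurable_slabMeasure (x := fun p : (Fin (n + 1) → ℝ) × (Fin (n + 1) → ℝ) =>
      fun i => g (p.1 i) ^ k) (y := fun p => fun i => g' (p.2 i) ^ k) e f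
      (by fun_prop) (by fun_prop)
    unfold slabError
    fun_prop
  have hTk : 1 ≤ T ^ (2 * k) := one_le_pow₀ hT
  have hCne : C + ENNReal.ofReal K * (2 ^ (n + 1) * 2 ^ (n + 1)) ≠ ⊤ := by finiteness
  rw [← ENNReal.ofReal_le_ofReal_iff (by positivity), ← Real.enorm_eq_ofReal_abs,
    ENNReal.ofReal_mul ENNReal.toReal_nonneg, ENNReal.ofReal_toReal hCne]
  calc _ ≤ _ := enorm_integral_le_lintegral_enorm _
    _ ≤ _ := lintegral_mono_ae hpt
    _ = ∫⁻ u, ∫⁻ v, ENNReal.ofReal (slabError e f d (fun i => g (u i) ^ k)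
      (fun i => g' (v i) ^ k)) ∂cubeVol (n + 1) ∂cubeVol (n + 1) +
      ENNReal.ofReal (K * q) * (2 ^ (n + 1) * 2 ^ (n + 1)) := by
        rw [lintegral_add_left hmeas, lintegral_const, lintegral_prod _ hmeas.aemeasurable]
        congr 2
        rw [← Set.univ_prod_univ, Measure.prod_prod, cubeVol_univ]
    _ ≤ C * ENNReal.ofReal (T ^ (2 * k) * q) +
      ENNReal.ofReal (K * (T ^ (2 * k) * q)) * (2 ^ (n + 1) * 2 ^ (n + 1)) := by
        gcongr
        · exact hb h T e f hh hh1 hT he he' hf hf' g g' hg hg'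
        · have : 0 ≤ q := by positivity
          nlinarith
    _ = _ := by
        rw [ENNReal.ofReal_mul (by positivity) (p := K)]
        ring

/-- The key `L²` estimate: two normalised volumes at the same scale are close in mean square. -/
lemma integral_sq_normVol_sub_le (n k : ℕ) (hk : k ≠ 0) (hkn : 2 * k ≤ n) :
    ∃ C : ℝ, 0 ≤ C ∧
    ∀ (h T e f : ℝ) (_ : 0 < h) (_ : h ≤ 1) (_ : 1 ≤ T) (_ : (h / T) ^ k ≤ e) (_ : e ≤ h ^ k)
    (_ : (h / T) ^ k ≤ f) (_ : f ≤ h ^ k) (g g' : ℝ → ℝ) (_ : ApproxId h g) (_ : ApproxId h g'),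
    ∫ l, (normVol k (n + 1) e g l - normVol k (n + 1) f g' l) ^ 2 ∂gaussianPi (n + 1)
      ≤ C * (T ^ (2 * k) * h ^ (1 / 8 : ℝ)) := by
  obtain ⟨C, hC, hb⟩ := abs_integral_normVol_mul_sub_le n k hk hkn
  refine ⟨4 * C, by positivity, ?_⟩
  intro h T e f hh hh1 hT he he' hf hf' g g' hg hg'
  have hhT : 0 < (h / T) ^ k := by
    have : 0 < T := by linarith
    positivity
  have he0 : 0 < e := hhT.trans_le he
  have hf0 : 0 < f := hhT.trans_le hf
  have h1 := hb h T e e hh hh1 hT he he' he he' g g hg hg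
  have h2 := hb h T e f hh hh1 hT he he' hf hf' g g' hg hg'
  have h3 := hb h T f f hh hh1 hT hf hf' hf hf' g' g' hg' hg'
  have h4 : ∀ l, (normVol k (n + 1) e g l - normVol k (n + 1) f g' l) ^ 2 =
      normVol k (n + 1) e g l * normVol k (n + 1) e g l -
      2 * (normVol k (n + 1) e g l * normVol k (n + 1) f g' l) +
      normVol k (n + 1) f g' l * normVol k (n + 1) f g' l := fun l => by ring
  have i1 := integrable_normVol_mul (k := k) (s := n + 1) he0 he0 hg.meas hg.meas
  have i2 := integrable_normVol_mul (k := k) (s := n + 1) he0 hf0 hg.meas hg'.meas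
  have i3 := integrable_normVol_mul (k := k) (s := n + 1) hf0 hf0 hg'.meas hg'.meas
  simp_rw [h4]
  have i4 : Integrable (fun l => normVol k (n + 1) e g l * normVol k (n + 1) e g l -
      2 * (normVol k (n + 1) e g l * normVol k (n + 1) f g' l)) (gaussianPi (n + 1)) :=
    i1.sub (i2.const_mul 2)
  rw [integral_add i4 i3, integral_sub i1 (i2.const_mul 2), integral_const_mul]
  have := (abs_le.1 h1).2
  have := (abs_le.1 h2).1
  have := (abs_le.1 h3).2
  linarith

/-- Rounding to the nearest multiple of `1 / Q`. -/
noncomputable def gridRound (Q t : ℝ) : ℝ := (⌊Q * t + 1 / 2⌋ : ℝ) / Q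

lemma measurable_gridRound (Q : ℝ) : Measurable (gridRound Q) := by
  unfold gridRound
  fun_prop

lemma approxId_gridRound (N : ℕ) :
    ApproxId (1 / ((N : ℝ) + 1 / 2)) (gridRound ((N : ℝ) + 1 / 2)) := by
  have hQ : 0 < (N : ℝ) + 1 / 2 := by positivity
  refine ⟨measurable_gridRound _, fun t ht => ?_, fun t ht => ?_⟩
  · unfold gridRound
    rw [abs_div, abs_of_pos hQ, div_le_one hQ]
    have h1 : -(N : ℤ) ≤ ⌊((N : ℝ) + 1 / 2) * t + 1 / 2⌋ := by
      apply Int.le_floor.2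
      push_cast
      nlinarith [ht.1]
    have h2 : ⌊((N : ℝ) + 1 / 2) * t + 1 / 2⌋ < (N : ℤ) + 1 := by
      apply Int.floor_lt.2
      push_cast
      nlinarith [ht.2]
    have h1' : -(N : ℝ) ≤ ⌊((N : ℝ) + 1 / 2) * t + 1 / 2⌋ := by exact_mod_cast h1
    have h2' : (⌊((N : ℝ) + 1 / 2) * t + 1 / 2⌋ : ℝ) ≤ N := by
      exact_mod_cast Int.lt_add_one_iff.1 h2
    rw [abs_le]
    constructor <;> linarith
  · have h3 : gridRound ((N : ℝ) + 1 / 2) t - t =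
        ((⌊((N : ℝ) + 1 / 2) * t + 1 / 2⌋ : ℝ) - ((N : ℝ) + 1 / 2) * t) / ((N : ℝ) + 1 / 2) := by
      unfold gridRound; field_simp
    rw [h3, abs_div, abs_of_pos hQ]
    gcongr
    have h4 := Int.floor_le (((N : ℝ) + 1 / 2) * t + 1 / 2)
    have h5 := Int.lt_floor_add_one (((N : ℝ) + 1 / 2) * t + 1 / 2)
    rw [abs_le]
    constructor <;> linarith

lemma approxId_id {h : ℝ} (hh : 0 ≤ h) : ApproxId h id :=
  ⟨measurable_id, fun t ht => abs_le.2 ⟨ht.1, ht.2.le⟩, fun t _ => by simpa using hh⟩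

lemma cubeLine_floor_eq {N : ℕ} {x : ℤ} (hx : |(x : ℝ)| ≤ N) :
    cubeLine {t | ⌊((N : ℝ) + 1 / 2) * t + 1 / 2⌋ = x} =
      ENNReal.ofReal (1 / ((N : ℝ) + 1 / 2)) := by
  have hQ : 0 < (N : ℝ) + 1 / 2 := by positivity
  set Q := (N : ℝ) + 1 / 2 with hQd
  have h1 : {t : ℝ | ⌊Q * t + 1 / 2⌋ = x} = Set.Ico ((x - 1 / 2) / Q) ((x + 1 / 2) / Q) := by
    ext t
    rw [Set.mem_ofPred_eq, Int.floor_eq_iff, Set.mem_Ico, div_le_iff₀ hQ, lt_div_iff₀ hQ]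
    constructor <;> rintro ⟨h1, h2⟩ <;> constructor <;> linarith
  have h2 : Set.Ico ((x - 1 / 2) / Q) ((x + 1 / 2) / Q) ⊆ Set.Ico (-1) 1 := by
    rw [abs_le] at hx
    apply Set.Ico_subset_Ico
    · rw [le_div_iff₀ hQ]; linarith
    · rw [div_le_iff₀ hQ]; linarith
  rw [h1, cubeLine, Measure.restrict_eq_self _ h2, Real.volume_Ico]
  congr 1
  field_simp
  ring

lemma finite_Ncount_set (k s : ℕ) (l : Fin s → ℝ) (P τ : ℝ) :
    {x : Fin s → ℤ | (∀ j, |((x j : ℤ) : ℝ)| ≤ P) ∧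
      |∑ j, l j * ((x j : ℤ) : ℝ) ^ k| < τ}.Finite := by
  refine (Set.Finite.pi' (t := fun _ : Fin s => Set.Icc (-⌊P⌋) ⌊P⌋)
    fun _ => Set.finite_Icc _ _).subset ?_
  rintro x ⟨hx, -⟩ j
  have h := abs_le.1 (hx j)
  refine ⟨?_, Int.le_floor.2 h.2⟩
  have : -x j ≤ ⌊P⌋ := Int.le_floor.2 (by push_cast; linarith)
  linarith

lemma Ncount_eq_cubeVol {k s : ℕ} (l : Fin s → ℝ) (N : ℕ) (τ : ℝ) :
    (Ncount k s l N τ : ℝ) = ((N : ℝ) + 1 / 2) ^ s *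
      (cubeVol s).real {v | |∑ i, l i * gridRound ((N : ℝ) + 1 / 2) (v i) ^ k| <
        τ / ((N : ℝ) + 1 / 2) ^ k} := by
  have hfin := finite_Ncount_set k s l N τ
  have hQ : 0 < (N : ℝ) + 1 / 2 := by positivity
  unfold Ncount
  set S := {x : Fin s → ℤ | (∀ j, |((x j : ℤ) : ℝ)| ≤ (N : ℝ)) ∧
      |∑ j, l j * ((x j : ℤ) : ℝ) ^ k| < τ} with hS
  set F : (Fin s → ℝ) → (Fin s → ℤ) := fun v i => ⌊((N : ℝ) + 1 / 2) * v i + 1 / 2⌋ with hF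
  have hFm : Measurable F := by rw [hF]; fun_prop
  have h1 : (cubeVol s) {v | |∑ i, l i * gridRound ((N : ℝ) + 1 / 2) (v i) ^ k| <
        τ / ((N : ℝ) + 1 / 2) ^ k} = cubeVol s (F ⁻¹' (hfin.toFinset : Set (Fin s → ℤ))) := by
    apply measure_congr
    filter_upwards [ae_cubeVol s] with v hv
    apply propext
    change |∑ i, l i * gridRound ((N : ℝ) + 1 / 2) (v i) ^ k| < τ / ((N : ℝ) + 1 / 2) ^ k ↔
      F v ∈ (hfin.toFinset : Set (Fin s → ℤ))
    rw [Set.Finite.coe_toFinset, hS, Set.mem_ofPred_eq]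
    have h2 : ∑ i, l i * gridRound ((N : ℝ) + 1 / 2) (v i) ^ k =
        (∑ i, l i * (F v i : ℝ) ^ k) / ((N : ℝ) + 1 / 2) ^ k := by
      rw [Finset.sum_div]
      refine Finset.sum_congr rfl fun i _ => ?_
      unfold gridRound
      rw [div_pow, mul_div_assoc]
    rw [h2, abs_div, abs_of_pos (pow_pos hQ k), div_lt_div_iff_of_pos_right (pow_pos hQ k)]
    refine ⟨fun h => ⟨fun j => ?_, h⟩, fun h => h.2⟩
    have h3 := (approxId_gridRound N).abs_le_one _ (hv j)
    unfold gridRound at h3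
    rw [abs_div, abs_of_pos hQ, div_le_one hQ] at h3
    change |(F v j : ℝ)| ≤ _ at h3
    have h4 : |F v j| < (N : ℤ) + 1 := by
      have : (|F v j| : ℝ) < N + 1 := by linarith
      exact_mod_cast this
    exact_mod_cast Int.lt_add_one_iff.1 h4
  have h5 : ∀ x ∈ hfin.toFinset, cubeVol s (F ⁻¹' {x}) =
      ENNReal.ofReal (1 / ((N : ℝ) + 1 / 2)) ^ s := by
    intro x hx
    rw [Set.Finite.mem_toFinset] at hx
    have : F ⁻¹' {x} = Set.univ.pi fun i => {t | ⌊((N : ℝ) + 1 / 2) * t + 1 / 2⌋ = x i} := by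
      ext v
      simp [hF, funext_iff]
    rw [this, cubeVol, Measure.pi_pi, Finset.prod_congr rfl fun i _ => cubeLine_floor_eq (hx.1 i)]
    simp
  rw [Measure.real, h1, ← sum_measure_preimage_singleton _ fun x _ => hFm (measurableSet_singleton x),
    Finset.sum_congr rfl h5, Finset.sum_const, Set.ncard_eq_toFinset_card _ hfin, nsmul_eq_mul,
    ENNReal.toReal_mul, ← ENNReal.ofReal_pow (by positivity), ENNReal.toReal_ofReal (by positivity)]
  simp
  field_simp

lemma Ncount_eq_normVol {k s : ℕ} (l : Fin s → ℝ) (N : ℕ) {τ : ℝ} (hτ : 0 < τ) :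
    (Ncount k s l N τ : ℝ) = 2 * τ * ((N : ℝ) + 1 / 2) ^ ((s : ℝ) - k) *
      normVol k s (τ / ((N : ℝ) + 1 / 2) ^ k) (gridRound ((N : ℝ) + 1 / 2)) l := by
  have hQ : 0 < (N : ℝ) + 1 / 2 := by positivity
  rw [Ncount_eq_cubeVol, normVol, Real.rpow_sub hQ, Real.rpow_natCast, Real.rpow_natCast]
  generalize (cubeVol s).real _ = V
  field_simp

lemma Ncount_mono {k s : ℕ} (l : Fin s → ℝ) {P P' τ τ' : ℝ} (hP : P ≤ P') (hτ : τ ≤ τ') :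
    Ncount k s l P τ ≤ Ncount k s l P' τ' :=
  Set.ncard_le_ncard (fun _ hx => ⟨fun j => (hx.1 j).trans hP, hx.2.trans_le hτ⟩)
    (finite_Ncount_set k s l P' τ')

lemma ae_bddAbove_of_summable_integral {Ω : Type*} [MeasurableSpace Ω] {μ : Measure Ω}
    {f : ℕ → Ω → ℝ} (h0 : ∀ m ω, 0 ≤ f m ω) (hf : ∀ m, Integrable (f m) μ)
    (hs : Summable fun m => ∫ ω, f m ω ∂μ) : ∀ᵐ ω ∂μ, ∃ B, 0 ≤ B ∧ ∀ m, f m ω ≤ B := by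
  have h1 : ∀ m, ∫⁻ ω, ENNReal.ofReal (f m ω) ∂μ = ENNReal.ofReal (∫ ω, f m ω ∂μ) := fun m =>
    (ofReal_integral_eq_lintegral_ofReal (hf m) (.of_forall (h0 m))).symm
  have hm : ∀ m, AEMeasurable (fun ω => ENNReal.ofReal (f m ω)) μ := fun m =>
    (hf m).aemeasurable.ennreal_ofReal
  have h2 : ∫⁻ ω, ∑' m, ENNReal.ofReal (f m ω) ∂μ ≠ ⊤ := by
    rw [lintegral_tsum hm]
    simp_rw [h1]
    exact hs.tsum_ofReal_ne_top
  filter_upwards [ae_lt_top' (AEMeasurable.tsum hm) h2] with ω hω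
  refine ⟨(∑' m, ENNReal.ofReal (f m ω)).toReal, ENNReal.toReal_nonneg, fun m => ?_⟩
  rw [← ENNReal.ofReal_le_iff_le_toReal hω.ne]
  exact ENNReal.le_tsum m

/-- The side length of the box used at stage `m` of the Borel–Cantelli argument. -/
noncomputable def gridScale (k m : ℕ) : ℝ := (((m + 1) ^ (64 * k) : ℕ) : ℝ) + 1 / 2

lemma gridScale_pos (k m : ℕ) : 0 < gridScale k m := by unfold gridScale; positivity

lemma pow_le_gridScale (k m : ℕ) : ((m : ℝ) + 1) ^ (64 * k) ≤ gridScale k m := by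
  unfold gridScale; push_cast; linarith

lemma one_le_gridScale (k m : ℕ) : 1 ≤ gridScale k m :=
  (one_le_pow₀ (by linarith [(Nat.cast_nonneg m : (0:ℝ) ≤ m)])).trans (pow_le_gridScale k m)

lemma gridScale_le_succ (k m : ℕ) : gridScale k m ≤ gridScale k (m + 1) := by
  unfold gridScale
  push_cast
  gcongr
  linarith

lemma gridScale_succ_le (k m : ℕ) : gridScale k (m + 1) ≤ 2 ^ (64 * k) * gridScale k m := by
  unfold gridScale
  push_cast
  have h1 : ((m : ℝ) + 1 + 1) ^ (64 * k) ≤ 2 ^ (64 * k) * ((m : ℝ) + 1) ^ (64 * k) := by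
    rw [← mul_pow]
    gcongr
    linarith [(Nat.cast_nonneg m : (0:ℝ) ≤ m)]
  have h2 : (1 : ℝ) ≤ 2 ^ (64 * k) := one_le_pow₀ (by norm_num)
  nlinarith

/-- The admissible thresholds at stage `m`. -/
def AdmThreshold (k m : ℕ) (e : ℝ) : Prop :=
  (1 / gridScale k m / (2 ^ (64 * k) * ((m : ℝ) + 1))) ^ k ≤ e ∧ e ≤ (1 / gridScale k m) ^ k

lemma AdmThreshold.pos {k m : ℕ} {e : ℝ} (h : AdmThreshold k m e) : 0 < e :=
  lt_of_lt_of_le (by have := gridScale_pos k m; positivity) h.1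

lemma admThreshold_div {k m j : ℕ} (hk : k ≠ 0) (hj : 1 ≤ j) (hjm : j ≤ m + 1) :
    AdmThreshold k m ((j : ℝ) / (m + 1) / gridScale k m ^ k) := by
  have hQ := gridScale_pos k m
  have hj' : (1 : ℝ) ≤ j := by exact_mod_cast hj
  have hjm' : (j : ℝ) ≤ m + 1 := by exact_mod_cast hjm
  have hm : (1 : ℝ) ≤ m + 1 := by linarith
  constructor
  · rw [div_pow, div_pow, one_pow, div_div, div_div]
    have h1 : (m : ℝ) + 1 ≤ (2 ^ (64 * k) * ((m : ℝ) + 1)) ^ k := by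
      have h2 : (m : ℝ) + 1 ≤ 2 ^ (64 * k) * ((m : ℝ) + 1) :=
        le_mul_of_one_le_left (by linarith) (one_le_pow₀ (by norm_num))
      exact h2.trans (le_self_pow₀ (hm.trans h2) hk)
    rw [mul_comm ((m : ℝ) + 1)]
    gcongr
  · rw [div_pow, one_pow]
    gcongr
    exact (div_le_one (by linarith)).2 hjm'

lemma admThreshold_succ (k m : ℕ) : AdmThreshold k m ((1 / gridScale k (m + 1)) ^ k) := by
  have hQ := gridScale_pos k m
  have hQ' := gridScale_pos k (m + 1)
  constructor
  · rw [div_div]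
    gcongr
    calc gridScale k (m + 1) ≤ 2 ^ (64 * k) * gridScale k m := gridScale_succ_le k m
      _ ≤ 2 ^ (64 * k) * gridScale k m * (m + 1) :=
        le_mul_of_one_le_right (by positivity) (by linarith [(Nat.cast_nonneg m : (0:ℝ) ≤ m)])
      _ = gridScale k m * (2 ^ (64 * k) * (m + 1)) := by ring
  · gcongr
    exact gridScale_le_succ k m

lemma integral_sq_normVol_sub_le_of_adm (n k : ℕ) (hk : 2 ≤ k) (hkn : 2 * k ≤ n) :
    ∃ C : ℝ, 0 ≤ C ∧ ∀ (m : ℕ) (e f : ℝ), AdmThreshold k m e → AdmThreshold k m f →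
      ∀ g g' : ℝ → ℝ, ApproxId (1 / gridScale k m) g → ApproxId (1 / gridScale k m) g' →
        ∫ l, (normVol k (n + 1) e g l - normVol k (n + 1) f g' l) ^ 2 ∂gaussianPi (n + 1) ≤
          C / ((m : ℝ) + 1) ^ 12 := by
  obtain ⟨C, hC0, hC⟩ := integral_sq_normVol_sub_le n k (by omega) hkn
  refine ⟨C * (2 ^ (64 * k)) ^ (2 * k), by positivity, fun m e f he hf g g' hg hg' => ?_⟩
  have hm : (1 : ℝ) ≤ (m : ℝ) + 1 := by linarith [(Nat.cast_nonneg m : (0:ℝ) ≤ m)]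
  have hQ := gridScale_pos k m
  refine (hC (1 / gridScale k m) (2 ^ (64 * k) * ((m : ℝ) + 1)) e f (by positivity)
    ((div_le_one hQ).2 (one_le_gridScale k m)) (one_le_mul_of_one_le_of_one_le
      (one_le_pow₀ (by norm_num)) hm) he.1 he.2 hf.1 hf.2 g g' hg hg').trans ?_
  have h1 : (1 / gridScale k m) ^ (1 / 8 : ℝ) ≤ 1 / ((m : ℝ) + 1) ^ (8 * k) := by
    have h2 : 1 / gridScale k m ≤ (1 / ((m : ℝ) + 1) ^ (8 * k)) ^ (8 : ℝ) := by
      have h3 : (1 / ((m : ℝ) + 1) ^ (8 * k)) ^ (8 : ℝ) = 1 / ((m : ℝ) + 1) ^ (64 * k) := by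
        rw [show (8 : ℝ) = ((8 : ℕ) : ℝ) by norm_num, Real.rpow_natCast, div_pow, one_pow, ← pow_mul]
        congr 2
        ring
      rw [h3]
      exact one_div_le_one_div_of_le (by positivity) (pow_le_gridScale k m)
    calc (1 / gridScale k m) ^ (1 / 8 : ℝ)
        ≤ ((1 / ((m : ℝ) + 1) ^ (8 * k)) ^ (8 : ℝ)) ^ (1 / 8 : ℝ) :=
          Real.rpow_le_rpow (by positivity) h2 (by norm_num)
      _ = 1 / ((m : ℝ) + 1) ^ (8 * k) := by
        rw [← Real.rpow_mul (by positivity)]; norm_num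
  have h4 : ((m : ℝ) + 1) ^ (2 * k) * (1 / ((m : ℝ) + 1) ^ (8 * k)) ≤ 1 / ((m : ℝ) + 1) ^ 12 := by
    rw [mul_one_div, div_le_div_iff₀ (by positivity) (by positivity), one_mul, ← pow_add]
    exact pow_le_pow_right₀ hm (by omega)
  calc C * ((2 ^ (64 * k) * ((m : ℝ) + 1)) ^ (2 * k) * (1 / gridScale k m) ^ (1 / 8 : ℝ))
      ≤ C * ((2 ^ (64 * k) * ((m : ℝ) + 1)) ^ (2 * k) * (1 / ((m : ℝ) + 1) ^ (8 * k))) := by gcongr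
    _ = C * (2 ^ (64 * k)) ^ (2 * k) *
        (((m : ℝ) + 1) ^ (2 * k) * (1 / ((m : ℝ) + 1) ^ (8 * k))) := by rw [mul_pow]; ring
    _ ≤ C * (2 ^ (64 * k)) ^ (2 * k) * (1 / ((m : ℝ) + 1) ^ 12) := by gcongr
    _ = _ := by ring

lemma approxId_gridRound_gridScale (k m : ℕ) :
    ApproxId (1 / gridScale k m) (gridRound (gridScale k m)) :=
  approxId_gridRound _

lemma integrable_sq_normVol_sub {k s : ℕ} {e f : ℝ} (he : 0 < e) (hf : 0 < f) {g g' : ℝ → ℝ}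
    (hg : Measurable g) (hg' : Measurable g') :
    Integrable (fun l => (normVol k s e g l - normVol k s f g' l) ^ 2) (gaussianPi s) := by
  have h := ((integrable_normVol_mul (k := k) he he hg hg).sub
    ((integrable_normVol_mul (k := k) (s := s) he hf hg hg').const_mul 2)).add
    (integrable_normVol_mul (k := k) hf hf hg' hg')
  refine h.congr (.of_forall fun l => ?_)
  simp only [Pi.add_apply, Pi.sub_apply]
  ring

/-- Total squared fluctuation of the normalised counts at stage `m`. -/
noncomputable def stageDefect (k s m : ℕ) (l : Fin s → ℝ) : ℝ :=
  ∑ j ∈ Finset.Icc (1 : ℕ) (m + 1),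
      (normVol k s ((j : ℝ) / (m + 1) / gridScale k m ^ k) (gridRound (gridScale k m)) l -
        normVol k s ((1 / gridScale k m) ^ k) id l) ^ 2 +
    (normVol k s ((1 / gridScale k m) ^ k) id l -
      normVol k s ((1 / gridScale k (m + 1)) ^ k) id l) ^ 2

lemma admThreshold_self {k : ℕ} (hk : k ≠ 0) (m : ℕ) :
    AdmThreshold k m ((1 / gridScale k m) ^ k) := by
  have h := admThreshold_div (m := m) hk (Nat.succ_le_succ (Nat.zero_le m)) le_rfl
  convert h using 1
  push_cast
  rw [div_self (by positivity), div_pow, one_pow]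

lemma ae_exists_stageDefect_le (n k : ℕ) (hk : 2 ≤ k) (hkn : 2 * k ≤ n) :
    ∀ᵐ l ∂gaussianPi (n + 1), ∃ B : ℝ, 0 ≤ B ∧ ∀ m : ℕ,
      ((m : ℝ) + 1) ^ 4 * stageDefect k (n + 1) m l ≤ B := by
  have hk0 : k ≠ 0 := by omega
  obtain ⟨C, hC0, hC⟩ := integral_sq_normVol_sub_le_of_adm n k hk hkn
  have hid : ∀ m, ApproxId (1 / gridScale k m) id := fun m =>
    approxId_id (by have := gridScale_pos k m; positivity)
  have hInt1 : ∀ m : ℕ, ∀ j ∈ Finset.Icc (1 : ℕ) (m + 1), Integrable (fun l =>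
      (normVol k (n + 1) ((j : ℝ) / (m + 1) / gridScale k m ^ k) (gridRound (gridScale k m)) l -
        normVol k (n + 1) ((1 / gridScale k m) ^ k) id l) ^ 2) (gaussianPi (n + 1)) := by
    intro m j hj
    rw [Finset.mem_Icc] at hj
    exact integrable_sq_normVol_sub (admThreshold_div hk0 hj.1 hj.2).pos
      (admThreshold_self hk0 m).pos (measurable_gridRound _) measurable_id
  have hInt2 : ∀ m, Integrable (fun l => (normVol k (n + 1) ((1 / gridScale k m) ^ k) id l -
      normVol k (n + 1) ((1 / gridScale k (m + 1)) ^ k) id l) ^ 2) (gaussianPi (n + 1)) :=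
    fun m => integrable_sq_normVol_sub (admThreshold_self hk0 m).pos (admThreshold_succ k m).pos
      measurable_id measurable_id
  have hInt : ∀ m, Integrable (stageDefect k (n + 1) m) (gaussianPi (n + 1)) := fun m =>
    (integrable_finsetSum _ (hInt1 m)).add (hInt2 m)
  have hnn : ∀ m l, 0 ≤ stageDefect k (n + 1) m l := fun m l => by
    unfold stageDefect; positivity
  refine ae_bddAbove_of_summable_integral (fun m l => mul_nonneg (by positivity) (hnn m l))
    (fun m => (hInt m).const_mul _) ?_
  have hsum : Summable fun m : ℕ => 2 * C / ((m : ℝ) + 1) ^ 2 := by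
    have h1 : Summable fun m : ℕ => 1 / (m : ℝ) ^ 2 := Real.summable_one_div_nat_pow.2 (by norm_num)
    have h2 := ((summable_nat_add_iff 1).2 h1).mul_left (2 * C)
    refine h2.congr fun m => ?_
    push_cast
    ring
  refine Summable.of_nonneg_of_le (fun m => integral_nonneg fun l =>
    mul_nonneg (by positivity) (hnn m l)) (fun m => ?_) hsum
  have hm : (1 : ℝ) ≤ (m : ℝ) + 1 := by linarith [(Nat.cast_nonneg m : (0:ℝ) ≤ m)]
  rw [integral_const_mul]
  have h3 : ∫ l, stageDefect k (n + 1) m l ∂gaussianPi (n + 1) ≤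
      ((m : ℝ) + 1) * (C / ((m : ℝ) + 1) ^ 12) + C / ((m : ℝ) + 1) ^ 12 := by
    unfold stageDefect
    rw [integral_add (integrable_finsetSum _ (hInt1 m)) (hInt2 m), integral_finsetSum _ (hInt1 m)]
    refine add_le_add ?_ (hC m _ _ (admThreshold_self hk0 m) (admThreshold_succ k m) _ _
      (hid m) (hid m))
    refine (Finset.sum_le_card_nsmul _ _ (C / ((m : ℝ) + 1) ^ 12) fun j hj => ?_).trans ?_
    · rw [Finset.mem_Icc] at hj
      exact hC m _ _ (admThreshold_div hk0 hj.1 hj.2) (admThreshold_self hk0 m) _ _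
        (approxId_gridRound_gridScale k m) (hid m)
    · simp
  calc ((m : ℝ) + 1) ^ 4 * ∫ l, stageDefect k (n + 1) m l ∂gaussianPi (n + 1)
      ≤ ((m : ℝ) + 1) ^ 4 *
        (((m : ℝ) + 1) * (C / ((m : ℝ) + 1) ^ 12) + C / ((m : ℝ) + 1) ^ 12) := by gcongr
    _ = (((m : ℝ) + 1) + 1) * C / ((m : ℝ) + 1) ^ 8 := by field_simp
    _ ≤ 2 * ((m : ℝ) + 1) * C / ((m : ℝ) + 1) ^ 8 := by gcongr; linarith
    _ = 2 * C / ((m : ℝ) + 1) ^ 7 := by field_simp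
    _ ≤ 2 * C / ((m : ℝ) + 1) ^ 2 := by
      exact div_le_div_of_nonneg_left (by positivity) (by positivity)
        (pow_le_pow_right₀ hm (by norm_num))

lemma exists_limit_of_abs_sub_succ_le {G : ℕ → ℝ} {B : ℝ} (hB : 0 ≤ B)
    (hG : ∀ m : ℕ, |G m - G (m + 1)| ≤ B / ((m : ℝ) + 1) ^ 2) :
    ∃ J, ∀ m : ℕ, |G m - J| ≤ 2 * B / ((m : ℝ) + 1) := by
  have hstep : ∀ m : ℕ, |G m - G (m + 1)| ≤
      2 * B / ((m : ℝ) + 1) - 2 * B / (((m + 1 : ℕ) : ℝ) + 1) := by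
    intro m
    refine (hG m).trans ?_
    push_cast
    have h1 : 2 * B / ((m : ℝ) + 1) - 2 * B / ((m : ℝ) + 1 + 1) =
        2 * B / (((m : ℝ) + 1) * ((m : ℝ) + 1 + 1)) := by field_simp; ring
    rw [h1, div_le_div_iff₀ (by positivity) (by positivity)]
    nlinarith [mul_nonneg hB (Nat.cast_nonneg m : (0:ℝ) ≤ m), (Nat.cast_nonneg m : (0:ℝ) ≤ m),
      mul_nonneg hB (sq_nonneg (m : ℝ))]
  have hmono : Monotone fun m : ℕ => G m - 2 * B / ((m : ℝ) + 1) :=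
    monotone_nat_of_le_succ fun m => by have := (abs_le.1 (hstep m)).2; linarith
  have hanti : Antitone fun m : ℕ => G m + 2 * B / ((m : ℝ) + 1) :=
    antitone_nat_of_succ_le fun m => by have := (abs_le.1 (hstep m)).1; linarith
  have hle : (fun m : ℕ => G m - 2 * B / ((m : ℝ) + 1)) ≤
      fun m : ℕ => G m + 2 * B / ((m : ℝ) + 1) := fun m => by
    have : 0 ≤ 2 * B / ((m : ℝ) + 1) := by positivity
    change G m - _ ≤ G m + _
    linarith
  have h := Monotone.ciSup_mem_iInter_Icc_of_antitone hmono hanti hle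
  refine ⟨⨆ m : ℕ, (G m - 2 * B / ((m : ℝ) + 1)), fun m => ?_⟩
  have hm := Set.mem_iInter.1 h m
  rw [abs_le]
  constructor <;> linarith [hm.1, hm.2]

lemma abs_le_div_of_mul_sq_le {x B M : ℝ} (hM : 0 < M) (h : M ^ 4 * x ^ 2 ≤ B) :
    |x| ≤ √B / M ^ 2 := by
  rw [le_div_iff₀ (by positivity)]
  apply Real.le_sqrt_of_sq_le
  rw [mul_pow, sq_abs]
  linarith

lemma ae_exists_normVol_limit (n k : ℕ) (hk : 2 ≤ k) (hkn : 2 * k ≤ n) :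
    ∀ᵐ l ∂gaussianPi (n + 1), ∃ J B : ℝ, 0 ≤ B ∧
      (∀ m : ℕ, |normVol k (n + 1) ((1 / gridScale k m) ^ k) id l - J| ≤ B / ((m : ℝ) + 1)) ∧
      ∀ m j : ℕ, 1 ≤ j → j ≤ m + 1 →
        |normVol k (n + 1) ((j : ℝ) / (m + 1) / gridScale k m ^ k)
          (gridRound (gridScale k m)) l - J| ≤ B / ((m : ℝ) + 1) := by
  filter_upwards [ae_exists_stageDefect_le n k hk hkn] with l ⟨B, hB, hl⟩
  have hs := Real.sqrt_nonneg B
  have h2 : ∀ m : ℕ, |normVol k (n + 1) ((1 / gridScale k m) ^ k) id l -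
      normVol k (n + 1) ((1 / gridScale k (m + 1)) ^ k) id l| ≤ √B / ((m : ℝ) + 1) ^ 2 := by
    intro m
    refine abs_le_div_of_mul_sq_le (by positivity) (le_trans ?_ (hl m))
    gcongr
    exact le_add_of_nonneg_left (by positivity)
  obtain ⟨J, hJ⟩ := exists_limit_of_abs_sub_succ_le hs h2
  refine ⟨J, 3 * √B, by positivity, fun m => (hJ m).trans (by gcongr; norm_num),
    fun m j h1 hjm => ?_⟩
  have hm : (1 : ℝ) ≤ (m : ℝ) + 1 := by linarith [(Nat.cast_nonneg m : (0:ℝ) ≤ m)]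
  have h3 : |normVol k (n + 1) ((j : ℝ) / (m + 1) / gridScale k m ^ k)
      (gridRound (gridScale k m)) l - normVol k (n + 1) ((1 / gridScale k m) ^ k) id l| ≤
      √B / ((m : ℝ) + 1) ^ 2 := by
    refine abs_le_div_of_mul_sq_le (by positivity) (le_trans ?_ (hl m))
    gcongr
    refine le_trans ?_ (le_add_of_nonneg_right (sq_nonneg _))
    exact Finset.single_le_sum (f := fun j : ℕ => (normVol k (n + 1)
      ((j : ℝ) / (m + 1) / gridScale k m ^ k) (gridRound (gridScale k m)) l -
      normVol k (n + 1) ((1 / gridScale k m) ^ k) id l) ^ 2) (fun _ _ => sq_nonneg _)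
      (Finset.mem_Icc.2 ⟨h1, hjm⟩)
  have h4 : √B / ((m : ℝ) + 1) ^ 2 ≤ √B / ((m : ℝ) + 1) := by
    gcongr
    exact le_self_pow₀ hm (by norm_num)
  calc _ ≤ _ := abs_sub_le _ _ _
    _ ≤ √B / ((m : ℝ) + 1) + 2 * √B / ((m : ℝ) + 1) := add_le_add (h3.trans h4) (hJ m)
    _ = 3 * √B / ((m : ℝ) + 1) := by ring

lemma cubeVol_pos_of_isOpen {n : ℕ} {O : Set (Fin n → ℝ)} (hO : IsOpen O) (hne : O.Nonempty)
    (hsub : O ⊆ Set.univ.pi fun _ => Set.Ico (-1) 1) : 0 < cubeVol n O := by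
  have h : cubeVol n = (volume : Measure (Fin n → ℝ)).restrict
      (Set.univ.pi fun _ => Set.Ico (-1) 1) := by
    rw [volume_pi, Measure.restrict_pi_pi]
    rfl
  rw [h, Measure.restrict_eq_self _ hsub]
  exact hO.measure_pos _ hne

lemma exists_pow_mul_mem_Ioo {k : ℕ} {a b : ℝ} (hk : k ≠ 0) (ha : a ≠ 0) (hb : b ≠ 0)
    (hab : Even k → a * b < 0) :
    ∃ y : ℝ, |y| < 1 ∧ -(b * y ^ k) / a ∈ Set.Ioo (0 : ℝ) ((1 / 2) ^ k) := by
  obtain ⟨σ, hσ, hσk⟩ : ∃ σ : ℝ, |σ| = 1 ∧ -(b * σ ^ k) / a = |b / a| := by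
    rcases lt_or_ge (a * b) 0 with h | h
    · refine ⟨1, by simp, ?_⟩
      have : b / a < 0 := by
        rw [div_eq_mul_inv, ← neg_pos, ← neg_mul]
        rcases lt_or_gt_of_ne ha with h1 | h1
        · have : 0 < b := by by_contra! h2; nlinarith
          nlinarith [inv_lt_zero.2 h1]
        · have : b < 0 := by by_contra! h2; nlinarith
          nlinarith [inv_pos.2 h1]
      rw [abs_of_neg this]
      simp [neg_div]
    · have hodd : Odd k := by
        by_contra h1
        exact absurd (hab (Nat.not_odd_iff_even.1 h1)) (not_lt.2 h)
      refine ⟨-1, by simp, ?_⟩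
      have : 0 ≤ b / a := by
        have h2 : b / a = a * b / a ^ 2 := by field_simp
        rw [h2]; positivity
      rw [abs_of_nonneg this, hodd.neg_one_pow]
      simp
  have hq : 0 < |b / a| := abs_pos.2 (div_ne_zero hb ha)
  set q := |b / a| with hqd
  refine ⟨σ * (1 / 2 * (1 / (1 + q))), ?_, ?_⟩
  · rw [abs_mul, hσ, one_mul, abs_of_pos (by positivity)]
    have : 1 / (1 + q) < 1 := (div_lt_one (by positivity)).2 (by linarith)
    nlinarith
  · have h1 : -(b * (σ * (1 / 2 * (1 / (1 + q)))) ^ k) / a =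
        (1 / 2) ^ k * (q * (1 / (1 + q)) ^ k) := by
      rw [← hσk, mul_pow σ, mul_pow (1 / 2 : ℝ)]
      ring
    rw [h1]
    refine ⟨by positivity, mul_lt_of_lt_one_right (by positivity) ?_⟩
    have h2 : (1 / (1 + q)) ^ k ≤ 1 / (1 + q) :=
      pow_le_of_le_one (by positivity) ((div_le_one (by positivity)).2 (by linarith)) hk
    calc q * (1 / (1 + q)) ^ k ≤ q * (1 / (1 + q)) := by gcongr
      _ < 1 := by rw [mul_one_div, div_lt_one (by positivity)]; linarith

/-- If the form has a suitable pair of coefficients, its slabs have volume at least a constant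
times their width. -/
lemma exists_le_normVol_id {n k : ℕ} (hk : k ≠ 0) {l : Fin (n + 1) → ℝ} (i : Fin (n + 1))
    (j : Fin n) (hi : l i ≠ 0) (hj : l (i.succAbove j) ≠ 0)
    (hij : Even k → l i * l (i.succAbove j) < 0) :
    ∃ c e₀ : ℝ, 0 < c ∧ 0 < e₀ ∧ ∀ e, 0 < e → e ≤ e₀ → c ≤ normVol k (n + 1) e id l := by
  obtain ⟨y, hy1, hy⟩ := exists_pow_mul_mem_Ioo hk hi hj hij
  set T : (Fin n → ℝ) → ℝ := fun w => -(∑ p, l (i.succAbove p) * w p ^ k) / l i with hT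
  have hTc : Continuous T := by rw [hT]; fun_prop
  set O : Set (Fin n → ℝ) :=
    (Set.univ.pi fun _ => Set.Ioo (-1) 1) ∩ T ⁻¹' Set.Ioo 0 ((1 / 2) ^ k) with hOd
  have hO : IsOpen O := (isOpen_set_pi Set.finite_univ fun _ _ => isOpen_Ioo).inter
    (isOpen_Ioo.preimage hTc)
  have hne : O.Nonempty := by
    refine ⟨Pi.single j y, fun p _ => ?_, ?_⟩
    · rw [Set.mem_Ioo, ← abs_lt]
      by_cases hp : p = j
      · subst hp; simpa using hy1
      · simp [hp]
    · change T _ ∈ Set.Ioo _ _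
      have : T (Pi.single j y) = -(l (i.succAbove j) * y ^ k) / l i := by
        rw [hT]
        dsimp only
        rw [Finset.sum_eq_single j]
        · simp
        · intro p _ hp
          simp [hp, hk]
        · simp
      rwa [this]
  have hpos : 0 < cubeVol n O := cubeVol_pos_of_isOpen hO hne
    (Set.inter_subset_left.trans (Set.pi_mono fun _ _ => Set.Ioo_subset_Ico_self))
  have hposr : 0 < (cubeVol n).real O := ENNReal.toReal_pos hpos.ne' (measure_ne_top _ _)
  have hkl : 0 < (k : ℝ) * |l i| := mul_pos (by positivity) (abs_pos.2 hi)
  refine ⟨(cubeVol n).real O / (k * |l i|), k * |l i| / 2, by positivity, by positivity,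
    fun e he hle => ?_⟩
  set d := e / (k * |l i|) with hd
  have hd0 : 0 < d := by positivity
  have hd2 : d ≤ 1 / 2 := by
    rw [hd, div_le_iff₀ hkl]; linarith
  set S : Set (Fin (n + 1) → ℝ) := {v | |∑ p, l p * id (v p) ^ k| < e} with hS
  have hSm : MeasurableSet S := measurableSet_lt (by fun_prop) (by fun_prop)
  have key : ∀ w ∈ O, ENNReal.ofReal (2 * d) ≤
      ∫⁻ t, S.indicator 1 (i.insertNth (α := fun _ => ℝ) t w) ∂cubeLine := by
    intro w hw
    have hw2 : T w ∈ Set.Ioo 0 ((1 / 2 : ℝ) ^ k) := hw.2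
    set r := T w ^ ((k : ℝ)⁻¹) with hr
    have hr0 : 0 ≤ r := Real.rpow_nonneg hw2.1.le _
    have hrk : r ^ k = T w := Real.rpow_inv_natCast_pow hw2.1.le hk
    have hr1 : r < 1 / 2 := by
      refine lt_of_pow_lt_pow_left₀ k (by norm_num) ?_
      rw [hrk]; exact hw2.2
    have hsub : Set.Ioo (r - d) (r + d) ⊆ Set.Ico (-1) 1 := fun t ht =>
      ⟨by linarith [ht.1], by linarith [ht.2]⟩
    calc ENNReal.ofReal (2 * d) = cubeLine (Set.Ioo (r - d) (r + d)) := by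
          rw [cubeLine, Measure.restrict_eq_self _ hsub, Real.volume_Ioo]
          congr 1
          ring
      _ = ∫⁻ t, (Set.Ioo (r - d) (r + d)).indicator 1 t ∂cubeLine :=
          (lintegral_indicator_one measurableSet_Ioo).symm
      _ ≤ _ := by
          refine lintegral_mono fun t => ?_
          by_cases ht : t ∈ Set.Ioo (r - d) (r + d)
          · have hmem : i.insertNth (α := fun _ => ℝ) t w ∈ S := by
              rw [hS, Set.mem_ofPred_eq, Fin.sum_univ_succAbove _ i]
              simp only [Fin.insertNth_apply_same, Fin.insertNth_apply_succAbove, id]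
              have h1 : l i * t ^ k + ∑ p, l (i.succAbove p) * w p ^ k =
                  l i * (t ^ k - r ^ k) := by
                rw [hrk, hT]
                field_simp
                ring
              have hti := hsub ht
              have h2 : |t ^ k - r ^ k| ≤ k * |t - r| :=
                abs_pow_sub_pow_le_mul (abs_le.2 ⟨hti.1, hti.2.le⟩)
                  (abs_le.2 ⟨by linarith, by linarith⟩) k
              have h3 : |t - r| < d := abs_lt.2 ⟨by linarith [ht.1], by linarith [ht.2]⟩
              rw [h1, abs_mul]
              calc |l i| * |t ^ k - r ^ k| ≤ |l i| * (k * |t - r|) := by gcongr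
                _ = (k * |l i|) * |t - r| := by ring
                _ < (k * |l i|) * d := by gcongr
                _ = e := by rw [hd]; field_simp
            rw [Set.indicator_of_mem hmem]
            exact Set.indicator_le_self' (fun _ _ => zero_le) t
          · rw [Set.indicator_of_notMem ht]
            exact zero_le
  have hF : Measurable (S.indicator (1 : (Fin (n + 1) → ℝ) → ENNReal)) :=
    measurable_one.indicator hSm
  have hvol : cubeVol n O * ENNReal.ofReal (2 * d) ≤ cubeVol (n + 1) S := by
    rw [← lintegral_indicator_one hSm, lintegral_cubeVol_succAbove i hF, lintegral_lintegral_swap]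
    · calc cubeVol n O * ENNReal.ofReal (2 * d)
          = ∫⁻ _ in O, ENNReal.ofReal (2 * d) ∂cubeVol n := by
            rw [setLIntegral_const, mul_comm]
        _ ≤ ∫⁻ w in O, ∫⁻ t, S.indicator 1 (i.insertNth (α := fun _ => ℝ) t w) ∂cubeLine
              ∂cubeVol n := setLIntegral_mono' hO.measurableSet key
        _ ≤ _ := setLIntegral_le_lintegral _ _
    · refine (hF.comp (f := fun p : ℝ × (Fin n → ℝ) =>
        i.insertNth (α := fun _ => ℝ) p.1 p.2) ?_).aemeasurable
      exact (MeasurableEquiv.piFinSuccAbove (fun _ : Fin (n + 1) => ℝ) i).symm.measurable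
  have hreal : (cubeVol n).real O * (2 * d) ≤ (cubeVol (n + 1)).real S := by
    have := ENNReal.toReal_mono (measure_ne_top _ _) hvol
    rwa [ENNReal.toReal_mul, ENNReal.toReal_ofReal (by positivity)] at this
  rw [normVol, le_div_iff₀ (by positivity)]
  calc (cubeVol n).real O / (k * |l i|) * (2 * e) = (cubeVol n).real O * (2 * d) := by
        rw [hd]; ring
    _ ≤ _ := hreal

lemma exists_le_normVol_id_of_mem_Lam {n k : ℕ} (hk : k ≠ 0) (hn : n ≠ 0) {l : Fin (n + 1) → ℝ}
    (hl : l ∈ Lam k (n + 1)) :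
    ∃ c e₀ : ℝ, 0 < c ∧ 0 < e₀ ∧ ∀ e, 0 < e → e ≤ e₀ → c ≤ normVol k (n + 1) e id l := by
  obtain ⟨h0, hev⟩ := hl
  by_cases h : Even k
  · obtain ⟨i, j, hij⟩ := hev h
    have hne : j ≠ i := by
      rintro rfl
      nlinarith [mul_self_nonneg (l j)]
    obtain ⟨j', rfl⟩ := Fin.exists_succAbove_eq hne
    exact exists_le_normVol_id hk i j' (h0 _) (h0 _) fun _ => hij
  · obtain ⟨m, rfl⟩ := Nat.exists_eq_succ_of_ne_zero hn
    exact exists_le_normVol_id hk 0 0 (h0 _) (h0 _) fun h' => absurd h' h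

lemma one_add_mul_pow_le {c x : ℝ} (hc : 0 ≤ c) (hx0 : 0 ≤ x) (hx1 : x ≤ 1) (d : ℕ) :
    (1 + c * x) ^ d ≤ 1 + (1 + c) ^ d * x := by
  have h := (convexOn_pow d).2 (Set.mem_Ici.2 zero_le_one) (Set.mem_Ici.2 (by positivity : 0 ≤ 1 + c))
    (by linarith : 0 ≤ 1 - x) hx0 (by ring)
  simp only [smul_eq_mul, one_pow, mul_one] at h
  calc (1 + c * x) ^ d = (1 - x + x * (1 + c)) ^ d := by ring
    _ ≤ 1 - x + x * (1 + c) ^ d := h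
    _ ≤ _ := by linarith

lemma gridScale_succ_pow_le {k : ℕ} (hk : k ≠ 0) (d : ℕ) : ∃ K : ℝ, 0 ≤ K ∧ ∀ m : ℕ,
    gridScale k (m + 1) ^ d ≤
      (((m : ℝ) + 1) ^ (64 * k)) ^ d * (1 + K * (1 / ((m : ℝ) + 1))) := by
  refine ⟨(1 + (2 ^ (64 * k) + 1)) ^ d, by positivity, fun m => ?_⟩
  set x : ℝ := 1 / ((m : ℝ) + 1) with hx
  have hm : (1 : ℝ) ≤ (m : ℝ) + 1 := by linarith [(Nat.cast_nonneg m : (0:ℝ) ≤ m)]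
  have hx0 : 0 ≤ x := by positivity
  have hx1 : x ≤ 1 := (div_le_one (by positivity)).2 hm
  have h1 : ((m : ℝ) + 1 + 1) ^ (64 * k) ≤
      ((m : ℝ) + 1) ^ (64 * k) * (1 + 2 ^ (64 * k) * x) := by
    have h2 : ((m : ℝ) + 1 + 1) = ((m : ℝ) + 1) * (1 + 1 * x) := by rw [hx]; field_simp
    rw [h2, mul_pow]
    gcongr
    have := one_add_mul_pow_le zero_le_one hx0 hx1 (64 * k)
    norm_num at this ⊢
    exact this
  have h3 : 1 / 2 ≤ ((m : ℝ) + 1) ^ (64 * k) * x := by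
    have h4 : (m : ℝ) + 1 ≤ ((m : ℝ) + 1) ^ (64 * k) := le_self_pow₀ hm (by omega)
    have h5 : ((m : ℝ) + 1) * x = 1 := by rw [hx]; field_simp
    nlinarith
  have h6 : gridScale k (m + 1) ≤ ((m : ℝ) + 1) ^ (64 * k) * (1 + (2 ^ (64 * k) + 1) * x) := by
    unfold gridScale
    push_cast
    linarith
  calc gridScale k (m + 1) ^ d
      ≤ (((m : ℝ) + 1) ^ (64 * k) * (1 + (2 ^ (64 * k) + 1) * x)) ^ d :=
        pow_le_pow_left₀ (gridScale_pos k _).le h6 d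
    _ = (((m : ℝ) + 1) ^ (64 * k)) ^ d * (1 + (2 ^ (64 * k) + 1) * x) ^ d := mul_pow _ _ _
    _ ≤ _ := by
      gcongr
      exact one_add_mul_pow_le (by positivity) hx0 hx1 d

lemma Ncount_zero (k s : ℕ) (l : Fin s → ℝ) (P : ℝ) : Ncount k s l P 0 = 0 := by
  unfold Ncount
  convert Set.ncard_empty (Fin s → ℤ)
  ext x
  simp only [Set.mem_ofPred_eq, Set.mem_empty_iff_false, iff_false]
  exact fun h => (abs_nonneg _).not_gt h.2

/-- Asymptotics of the counting function at the lattice of reference scales. -/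
lemma abs_Ncount_sub_le_of_limit {k s : ℕ} (hks : k ≤ s) {l : Fin s → ℝ} {J B : ℝ} (hB : 0 ≤ B)
    (hl : ∀ m j : ℕ, 1 ≤ j → j ≤ m + 1 → |normVol k s ((j : ℝ) / (m + 1) / gridScale k m ^ k)
      (gridRound (gridScale k m)) l - J| ≤ B / ((m : ℝ) + 1)) (m j : ℕ) (hj : j ≤ m + 1) :
    |(Ncount k s l (((m : ℝ) + 1) ^ (64 * k)) ((j : ℝ) / (m + 1)) : ℝ) -
      2 * ((j : ℝ) / (m + 1)) * J * gridScale k m ^ (s - k)| ≤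
      2 * B * (1 / ((m : ℝ) + 1)) * gridScale k m ^ (s - k) := by
  have hQ := gridScale_pos k m
  rcases Nat.eq_zero_or_pos j with rfl | hj1
  · simp only [Nat.cast_zero, zero_div, Ncount_zero]
    simp only [mul_zero, zero_mul, sub_zero, abs_zero]
    positivity
  have hτ : 0 < (j : ℝ) / (m + 1) := by positivity
  have hτ1 : (j : ℝ) / (m + 1) ≤ 1 := by
    rw [div_le_one (by positivity)]; exact_mod_cast hj
  have h1 := Ncount_eq_normVol (k := k) l ((m + 1) ^ (64 * k)) hτ
  change _ = 2 * _ * gridScale k m ^ _ * normVol k s (_ / gridScale k m ^ k)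
    (gridRound (gridScale k m)) l at h1
  push_cast at h1
  rw [h1, ← Nat.cast_sub hks, Real.rpow_natCast]
  have h2 := hl m j hj1 hj
  generalize normVol k s ((j : ℝ) / (m + 1) / gridScale k m ^ k)
    (gridRound (gridScale k m)) l = V at h2 ⊢
  calc _ = |2 * ((j : ℝ) / (m + 1)) * gridScale k m ^ (s - k) * (V - J)| := by congr 1; ring
    _ = 2 * ((j : ℝ) / (m + 1)) * gridScale k m ^ (s - k) * |V - J| := by
      rw [abs_mul, abs_of_nonneg (by positivity)]
    _ ≤ 2 * 1 * gridScale k m ^ (s - k) * (B / ((m : ℝ) + 1)) := by gcongr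
    _ = _ := by ring

lemma abs_Ncount_sub_le_of_mem_Ico {k s : ℕ} (hk : k ≠ 0) (hks : k ≤ s) {l : Fin s → ℝ}
    {J B : ℝ} (hJ : 0 ≤ J) (hB : 0 ≤ B)
    (hl : ∀ m j : ℕ, 1 ≤ j → j ≤ m + 1 → |normVol k s ((j : ℝ) / (m + 1) / gridScale k m ^ k)
      (gridRound (gridScale k m)) l - J| ≤ B / ((m : ℝ) + 1)) :
    ∃ C : ℝ, 0 ≤ C ∧ ∀ (m : ℕ) (P τ : ℝ), ((m : ℝ) + 1) ^ (64 * k) ≤ P →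
      P ≤ ((m : ℝ) + 2) ^ (64 * k) → 0 < τ → τ ≤ 1 →
      |(Ncount k s l P τ : ℝ) - 2 * τ * J * P ^ (s - k)| ≤ C * (1 / ((m : ℝ) + 1)) * P ^ (s - k) := by
  obtain ⟨K, hK, hKm⟩ := gridScale_succ_pow_le hk (s - k)
  refine ⟨2 * J * K + 2 * J * (1 + K) + 2 * B * (1 + K), by positivity,
    fun m P τ hP1 hP2 hτ0 hτ1 => ?_⟩
  have hm : (1 : ℝ) ≤ (m : ℝ) + 1 := by linarith [(Nat.cast_nonneg m : (0:ℝ) ≤ m)]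
  set x : ℝ := 1 / ((m : ℝ) + 1) with hx
  have hx0 : 0 ≤ x := by positivity
  have hx1 : x ≤ 1 := (div_le_one (by positivity)).2 hm
  have hx2 : 1 / (((m + 1 : ℕ) : ℝ) + 1) ≤ x := by
    push_cast
    exact one_div_le_one_div_of_le (by positivity) (by linarith)
  have hP0 : 0 < P := lt_of_lt_of_le (by positivity) hP1
  set d := s - k with hd
  have hU : (((m : ℝ) + 1) ^ (64 * k)) ^ d ≤ P ^ d := pow_le_pow_left₀ (by positivity) hP1 d
  have hY1 : gridScale k (m + 1) ^ d ≤ P ^ d * (1 + K * x) := (hKm m).trans (by gcongr)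
  have hY0 : gridScale k m ^ d ≤ P ^ d * (1 + K * x) :=
    (pow_le_pow_left₀ (gridScale_pos k m).le (gridScale_le_succ k m) d).trans hY1
  have hK1 : P ^ d * (1 + K * x) ≤ P ^ d * (1 + K) := by
    gcongr
    exact mul_le_of_le_one_right hK hx1
  have hlow : P ^ d - K * x * P ^ d ≤ gridScale k m ^ d := by
    have h1 : P ^ d ≤ gridScale k (m + 1) ^ d := by
      refine pow_le_pow_left₀ hP0.le (hP2.trans ?_) d
      refine le_trans (le_of_eq ?_) (pow_le_gridScale k (m + 1))
      push_cast
      ring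
    have h2 : (((m : ℝ) + 1) ^ (64 * k)) ^ d ≤ gridScale k m ^ d :=
      pow_le_pow_left₀ (by positivity) (pow_le_gridScale k m) d
    have h3 := h1.trans (hKm m)
    have h4 : (((m : ℝ) + 1) ^ (64 * k)) ^ d * (K * x) ≤ P ^ d * (K * x) := by gcongr
    linarith
  have hPd : 0 < P ^ d := by positivity
  rw [abs_le]
  constructor
  · set j := ⌊τ * ((m : ℝ) + 1)⌋₊ with hj
    have hj1 : (j : ℝ) ≤ τ * (m + 1) := Nat.floor_le (by positivity)
    have hj2 : τ * ((m : ℝ) + 1) < j + 1 := Nat.lt_floor_add_one _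
    have hjm : j ≤ m + 1 := by
      have : (j : ℝ) ≤ m + 1 := hj1.trans (mul_le_of_le_one_left (by positivity) hτ1)
      exact_mod_cast this
    have hq1 : (j : ℝ) / (m + 1) ≤ τ := by rwa [div_le_iff₀ (by positivity)]
    have hq2 : τ - x ≤ (j : ℝ) / (m + 1) := by
      rw [le_div_iff₀ (by positivity), sub_mul, hx, one_div_mul_cancel (by positivity)]
      linarith
    have hmono : (Ncount k s l (((m : ℝ) + 1) ^ (64 * k)) ((j : ℝ) / (m + 1)) : ℝ) ≤
        Ncount k s l P τ := by exact_mod_cast Ncount_mono l hP1 hq1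
    have hmain := (abs_le.1 (abs_Ncount_sub_le_of_limit hks hB hl m j hjm)).1
    rw [← hd, ← hx] at hmain
    have e1 : 2 * (τ - x) * J * gridScale k m ^ d ≤
        2 * ((j : ℝ) / (m + 1)) * J * gridScale k m ^ d := by
      have := gridScale_pos k m
      gcongr
    have e2 : 2 * τ * J * (P ^ d - K * x * P ^ d) ≤ 2 * τ * J * gridScale k m ^ d := by gcongr
    have e3 : 2 * x * J * gridScale k m ^ d ≤ 2 * x * J * (P ^ d * (1 + K)) := by
      gcongr; exact hY0.trans hK1
    have e4 : 2 * B * x * gridScale k m ^ d ≤ 2 * B * x * (P ^ d * (1 + K)) := by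
      gcongr; exact hY0.trans hK1
    have e5 : τ * (2 * J * K * x * P ^ d) ≤ 1 * (2 * J * K * x * P ^ d) := by gcongr
    linarith
  · set j := ⌈τ * (((m + 1 : ℕ) : ℝ) + 1)⌉₊ with hj
    have hj1 : τ * (((m + 1 : ℕ) : ℝ) + 1) ≤ j := Nat.le_ceil _
    have hj2 : (j : ℝ) < τ * (((m + 1 : ℕ) : ℝ) + 1) + 1 := Nat.ceil_lt_add_one (by positivity)
    have hjm : j ≤ (m + 1) + 1 := by
      refine Nat.ceil_le.2 ?_
      push_cast
      exact mul_le_of_le_one_left (by positivity) hτ1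
    have hq1 : τ ≤ (j : ℝ) / (((m + 1 : ℕ) : ℝ) + 1) := by rwa [le_div_iff₀ (by positivity)]
    have hq2 : (j : ℝ) / (((m + 1 : ℕ) : ℝ) + 1) ≤ τ + x := by
      refine le_trans ?_ (add_le_add_right hx2 τ)
      rw [div_le_iff₀ (by positivity), add_mul, one_div_mul_cancel (by positivity)]
      linarith
    have hP2' : P ≤ (((m + 1 : ℕ) : ℝ) + 1) ^ (64 * k) := by
      refine hP2.trans (le_of_eq ?_)
      push_cast
      ring
    have hmono : (Ncount k s l P τ : ℝ) ≤ Ncount k s l ((((m + 1 : ℕ) : ℝ) + 1) ^ (64 * k))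
        ((j : ℝ) / (((m + 1 : ℕ) : ℝ) + 1)) := by exact_mod_cast Ncount_mono l hP2' hq1
    have hmain := (abs_le.1 (abs_Ncount_sub_le_of_limit hks hB hl (m + 1) j hjm)).2
    rw [← hd] at hmain
    have hQ := gridScale_pos k (m + 1)
    have e1 : 2 * ((j : ℝ) / (((m + 1 : ℕ) : ℝ) + 1)) * J * gridScale k (m + 1) ^ d ≤
        2 * (τ + x) * J * gridScale k (m + 1) ^ d := by gcongr
    have e2 : 2 * τ * J * gridScale k (m + 1) ^ d ≤ 2 * τ * J * (P ^ d * (1 + K * x)) := by gcongr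
    have e3 : 2 * x * J * gridScale k (m + 1) ^ d ≤ 2 * x * J * (P ^ d * (1 + K)) := by
      gcongr; exact hY1.trans hK1
    have e4 : 2 * B * (1 / (((m + 1 : ℕ) : ℝ) + 1)) * gridScale k (m + 1) ^ d ≤
        2 * B * x * (P ^ d * (1 + K)) := by
      gcongr; exact hY1.trans hK1
    have e5 : τ * (2 * J * K * x * P ^ d) ≤ 1 * (2 * J * K * x * P ^ d) := by gcongr
    linarith

lemma dlt_lt {k : ℕ} (hk : 2 ≤ k) : dlt k < 1 / (64 * k) := by
  unfold dlt
  rw [one_div, pow_mul]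
  apply inv_strictAnti₀ (by positivity)
  obtain ⟨r, rfl⟩ : ∃ r, k = r + 1 := ⟨k - 1, by omega⟩
  have h : r + 1 < 64 ^ r := by
    calc r + 1 < 2 ^ (r + 1) := Nat.lt_two_pow_self
      _ ≤ 2 ^ (6 * r) := Nat.pow_le_pow_right (by norm_num) (by omega)
      _ = 64 ^ r := by rw [pow_mul]; norm_num
  have h' : ((r : ℝ) + 1) < 64 ^ r := by exact_mod_cast h
  push_cast
  rw [pow_succ]
  norm_num
  linarith

lemma exists_nat_pow_le_lt {A : ℕ} (hA : A ≠ 0) {P : ℝ} (hP : 1 ≤ P) :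
    ∃ m : ℕ, ((m : ℝ) + 1) ^ A ≤ P ∧ P ≤ ((m : ℝ) + 2) ^ A ∧
      1 / ((m : ℝ) + 1) ≤ 2 * P ^ (-(1 / (A : ℝ))) := by
  have hP0 : 0 ≤ P := zero_le_one.trans hP
  set R := P ^ ((A : ℝ)⁻¹) with hR
  have hR1 : 1 ≤ R := Real.one_le_rpow hP (by positivity)
  have hRA : R ^ A = P := Real.rpow_inv_natCast_pow hP0 hA
  obtain ⟨m, hm⟩ : ∃ m, ⌊R⌋₊ = m + 1 :=
    Nat.exists_eq_succ_of_ne_zero (Nat.floor_pos.2 hR1).ne'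
  have h1 : ((m : ℝ) + 1) ≤ R := by
    have := Nat.floor_le (zero_le_one.trans hR1)
    rw [hm] at this
    exact_mod_cast this
  have h2 : R ≤ (m : ℝ) + 2 := by
    have := (Nat.lt_floor_add_one R).le
    rw [hm] at this
    push_cast at this
    linarith
  refine ⟨m, ?_, ?_, ?_⟩
  · rw [← hRA]; gcongr
  · rw [← hRA]; gcongr
  · rw [Real.rpow_neg hP0, one_div (A : ℝ), ← hR, ← div_eq_mul_inv,
      div_le_div_iff₀ (by positivity) (by positivity)]
    linarith [(Nat.cast_nonneg m : (0:ℝ) ≤ m)]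

/-- Main Theorem: Let k ≥ 2, s > 2k and δ = 8^{−2k}. Then for almost all
λ ∈ Λ_k^{(s)} there are P₀ = P₀(λ,k) and a positive real J_{k,s}(λ) such that
|N^{(k)}_λ(P;τ) − 2τ J_{k,s}(λ) P^{s−k}| < P^{s−k−δ} for all P ≥ P₀, uniformly in
0 < τ ≤ 1. -/
theorem stmt19 (k s : ℕ) (hk : 2 ≤ k) (hs : 2 * k < s) :
    ∀ᵐ l : Fin s → ℝ ∂volume, l ∈ Lam k s →
      ∃ J : ℝ, 0 < J ∧ ∃ P₀ : ℝ, ∀ P : ℝ, P₀ ≤ P → ∀ τ : ℝ, 0 < τ → τ ≤ 1 →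
        |(Ncount k s l P τ : ℝ) - 2 * τ * J * P ^ ((s : ℝ) - k)|
          < P ^ ((s : ℝ) - k - dlt k) := by
  obtain ⟨n, rfl⟩ : ∃ n, s = n + 1 := ⟨s - 1, by omega⟩
  have hk0 : k ≠ 0 := by omega
  filter_upwards [(volume_absolutelyContinuous_gaussianPi (n + 1)).ae_le
    (ae_exists_normVol_limit n k hk (by omega))] with l ⟨J, B, hB, hJ1, hJ2⟩ hl
  obtain ⟨c, e₀, hc, he₀, hce⟩ := exists_le_normVol_id_of_mem_Lam hk0 (by omega) hl
  have hJ : 0 < J := by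
    have ht : Filter.Tendsto (fun m : ℕ => B / ((m : ℝ) + 1)) Filter.atTop (nhds 0) := by
      simpa [div_eq_mul_inv] using tendsto_one_div_add_atTop_nhds_zero_nat.const_mul B
    have ht' := tendsto_one_div_add_atTop_nhds_zero_nat (𝕜 := ℝ)
    obtain ⟨m, hm1, hm2⟩ := ((ht.eventually_lt_const hc).and
      (ht'.eventually_lt_const he₀)).exists
    have hQ := gridScale_pos k m
    have he : (1 / gridScale k m) ^ k ≤ e₀ := by
      refine le_trans ?_ hm2.le
      refine (pow_le_of_le_one (by positivity) ((div_le_one hQ).2 (one_le_gridScale k m))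
        hk0).trans ?_
      refine one_div_le_one_div_of_le (by positivity) (le_trans ?_ (pow_le_gridScale k m))
      exact le_self_pow₀ (by linarith [(Nat.cast_nonneg m : (0:ℝ) ≤ m)]) (by omega)
    have h1 := hce _ (by positivity) he
    have h2 := (abs_le.1 (hJ1 m)).2
    linarith
  obtain ⟨C, hC0, hC⟩ := abs_Ncount_sub_le_of_mem_Ico hk0 (by omega) hJ.le hB hJ2
  have hgap : 0 < 1 / (64 * (k : ℝ)) - dlt k := sub_pos.2 (dlt_lt hk)
  obtain ⟨P₁, hP₁⟩ := Filter.eventually_atTop.1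
    ((tendsto_rpow_atTop hgap).eventually_gt_atTop (2 * C))
  refine ⟨J, hJ, max P₁ 1, fun P hP τ hτ0 hτ1 => ?_⟩
  have hP1 : 1 ≤ P := (le_max_right _ _).trans hP
  have hP0 : 0 < P := by linarith
  obtain ⟨m, hm1, hm2, hm3⟩ := exists_nat_pow_le_lt (A := 64 * k) (by omega) hP1
  have h1 := hC m P τ hm1 hm2 hτ0 hτ1
  have hexp : P ^ (((n + 1 : ℕ) : ℝ) - k) = P ^ (n + 1 - k) := by
    rw [← Nat.cast_sub (by omega), Real.rpow_natCast]
  rw [← hexp] at h1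
  have h2 := hP₁ P ((le_max_left _ _).trans hP)
  push_cast at hm3
  calc _ ≤ _ := h1
    _ ≤ C * (2 * P ^ (-(1 / (64 * (k : ℝ))))) * P ^ (((n + 1 : ℕ) : ℝ) - k) := by gcongr
    _ = 2 * C * (P ^ (-(1 / (64 * (k : ℝ)))) * P ^ (((n + 1 : ℕ) : ℝ) - k)) := by ring
    _ < P ^ (1 / (64 * (k : ℝ)) - dlt k) *
        (P ^ (-(1 / (64 * (k : ℝ)))) * P ^ (((n + 1 : ℕ) : ℝ) - k)) := by gcongr
    _ = _ := by
      rw [← Real.rpow_add hP0, ← Real.rpow_add hP0]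
      congr 1
      ring
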